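/- Let N = 2, let q ∈ ℂ* be not a root of unity (or q = 1), and let ξ be a diagonal 2×2 complex matrix that is not a scalar multiple of any integral power of diag(q², 1). Then both co-orbit maps β^ξ and α^ξ map O(M_q) surjectively onto O(D\GL_q); in particular im(β^ξ) = im(α^ξ) is a quantum homogeneous space. Moreover, the kernel of β^ξ is the right ideal of O(M_q) generated by τ₁ − τ₁(ξ) and τ₂ − τ₂(ξ), and the kernel of α^ξ is the left ideal of O(M_q) generated by σ₁ − σ₁(ξ) and σ₂ − σ₂(ξ). -/

import Mathlib

open TensorProduct

noncomputable section

/-- Number of inversions (the length) of a permutation of `Fin t`. -/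
def invCount {t : ℕ} (σ : Equiv.Perm (Fin t)) : ℕ :=
  (Finset.univ.filter fun p : Fin t × Fin t => p.1 < p.2 ∧ σ p.2 < σ p.1).card

/-- The principal quantum minor `[I|I]` of the matrix of generators `x`. -/
def qMinor {A : Type} [CommRing A] {M : Type} [Ring M] [Algebra A M] {N : ℕ}
    (q : A) (x : Fin N → Fin N → M) (I : Finset (Fin N)) : M :=
  ∑ σ : Equiv.Perm (Fin I.card),
    ((-q) ^ invCount σ) •
      ((List.finRange I.card).map fun k =>
        x ((I.orderIsoOfFin rfl) k).1 ((I.orderIsoOfFin rfl) (σ k)).1).prod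

/-- The quantum determinant. -/
def qdet {A : Type} [CommRing A] {M : Type} [Ring M] [Algebra A M] {N : ℕ}
    (q : A) (x : Fin N → Fin N → M) : M :=
  qMinor q x Finset.univ

/-- `w(I)`: the sum of the elements of `I` (with `{1, …, N}` indexing). -/
def wtSet {N : ℕ} (I : Finset (Fin N)) : ℕ := ∑ j ∈ I, (j.1 + 1)

/-- The weighted sum `τ_i` of principal quantum minors of size `i`. -/
def tauCoinv {A : Type} [CommRing A] {M : Type} [Ring M] [Algebra A M] {N : ℕ}
    (q qinv : A) (x : Fin N → Fin N → M) (i : ℕ) : M :=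
  ∑ I ∈ Finset.univ.filter (fun I : Finset (Fin N) => I.card = i),
    qinv ^ (2 * wtSet I) • qMinor q x I

/-- The sum `σ_i` of all principal quantum minors of size `i`. -/
def sigmaCoinv {A : Type} [CommRing A] {M : Type} [Ring M] [Algebra A M] {N : ℕ}
    (q : A) (x : Fin N → Fin N → M) (i : ℕ) : M :=
  ∑ I ∈ Finset.univ.filter (fun I : Finset (Fin N) => I.card = i), qMinor q x I

/-- The right adjoint coaction `β(h) = Σ h₂ ⊗ S(h₁)h₃`. -/
def adjBeta {A : Type} [CommRing A] {M G : Type} [Ring M] [Algebra A M] [Ring G] [Algebra A G]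
    (ΔM : M →ₐ[A] M ⊗[A] M) (ι : M →ₐ[A] G) (St : G →ₗ[A] G) : M →ₗ[A] M ⊗[A] G :=
  TensorProduct.map LinearMap.id (LinearMap.mul' A G) ∘ₗ
  (TensorProduct.assoc A M G G).toLinearMap ∘ₗ
  TensorProduct.map
    ((TensorProduct.comm A G M).toLinearMap ∘ₗ
      TensorProduct.map (St ∘ₗ ι.toLinearMap) LinearMap.id)
    ι.toLinearMap ∘ₗ
  TensorProduct.map ΔM.toLinearMap LinearMap.id ∘ₗ ΔM.toLinearMap

/-- The right coaction `α(h) = Σ h₂ ⊗ h₃S(h₁)`. -/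
def adjAlpha {A : Type} [CommRing A] {M G : Type} [Ring M] [Algebra A M] [Ring G] [Algebra A G]
    (ΔM : M →ₐ[A] M ⊗[A] M) (ι : M →ₐ[A] G) (St : G →ₗ[A] G) : M →ₗ[A] M ⊗[A] G :=
  TensorProduct.map LinearMap.id (LinearMap.mul' A G) ∘ₗ
  TensorProduct.map LinearMap.id (TensorProduct.comm A G G).toLinearMap ∘ₗ
  (TensorProduct.assoc A M G G).toLinearMap ∘ₗ
  TensorProduct.map
    ((TensorProduct.comm A G M).toLinearMap ∘ₗ
      TensorProduct.map (St ∘ₗ ι.toLinearMap) LinearMap.id)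
    ι.toLinearMap ∘ₗ
  TensorProduct.map ΔM.toLinearMap LinearMap.id ∘ₗ ΔM.toLinearMap

/-- The co-orbit map associated to a point `e = ev_ξ` and a coaction `b`. -/
def coorbit {A : Type} [CommRing A] {M G : Type} [Ring M] [Algebra A M] [Ring G] [Algebra A G]
    (e : M →ₐ[A] A) (b : M →ₗ[A] M ⊗[A] G) : M →ₗ[A] G :=
  (TensorProduct.lid A G).toLinearMap ∘ₗ TensorProduct.map e.toLinearMap LinearMap.id ∘ₗ b

/-- The left coaction `λ_D = (π_D ⊗ id) ∘ Δ` of a quotient Hopf algebra. -/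
def leftCoact {A : Type} [CommRing A] {G D : Type} [Ring G] [Algebra A G]
    [CommRing D] [Algebra A D]
    (πD : G →ₐ[A] D) (ΔG : G →ₐ[A] G ⊗[A] G) : G →ₗ[A] D ⊗[A] G :=
  TensorProduct.map πD.toLinearMap LinearMap.id ∘ₗ ΔG.toLinearMap

/-- Coinvariants of the left coaction `λ_D`. -/
def dCoinv {A : Type} [CommRing A] {G D : Type} [Ring G] [Algebra A G]
    [CommRing D] [Algebra A D]
    (πD : G →ₐ[A] D) (ΔG : G →ₐ[A] G ⊗[A] G) : Set G :=
  {f : G | leftCoact πD ΔG f = (1 : D) ⊗ₜ[A] f}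

/-- The right coaction `ρ_D = (id ⊗ π_D) ∘ Δ`. -/
def rightCoact {A : Type} [CommRing A] {G D : Type} [Ring G] [Algebra A G]
    [CommRing D] [Algebra A D]
    (πD : G →ₐ[A] D) (ΔG : G →ₐ[A] G ⊗[A] G) : G →ₗ[A] G ⊗[A] D :=
  TensorProduct.map LinearMap.id πD.toLinearMap ∘ₗ ΔG.toLinearMap

/-- The weight space of weight `ta : D` for the grading induced by `ρ_D`. -/
def weightSpace' {A : Type} [CommRing A] {G D : Type} [Ring G] [Algebra A G]
    [CommRing D] [Algebra A D]
    (πD : G →ₐ[A] D) (ΔG : G →ₐ[A] G ⊗[A] G) (ta : D) : Submodule A G :=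
  LinearMap.ker (rightCoact πD ΔG - (TensorProduct.mk A G D).flip ta)

/-- The subcomodule generated by a subset `s` of the comodule `(M, b)`. -/
def comodGen {A : Type} [CommRing A] {M G : Type} [Ring M] [Algebra A M] [Ring G] [Algebra A G]
    (b : M →ₗ[A] M ⊗[A] G) (s : Set M) : Submodule A M :=
  sInf {W : Submodule A M | s ⊆ W ∧
    ∀ w ∈ W, b w ∈ LinearMap.range (TensorProduct.map W.subtype (LinearMap.id : G →ₗ[A] G))}

/-- The relations of `2 × 2` quantum matrices for the matrix with rows `(a, b)` and `(c, d)`. -/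
structure IsQuantumMat {R : Type} [Ring R] [Algebra ℂ R] (q : ℂ) (a b c d : R) : Prop where
  ab : a * b = q • (b * a)
  ac : a * c = q • (c * a)
  bd : b * d = q • (d * b)
  cd : c * d = q • (d * c)
  bc : b * c = c * b
  ad : a * d - d * a = (q - q⁻¹) • (b * c)

/-- Quantum matrices of quantum determinant one. -/
structure IsQuantumSL {R : Type} [Ring R] [Algebra ℂ R] (q : ℂ) (a b c d : R) : Prop
    extends IsQuantumMat q a b c d where
  det : a * d - q • (b * c) = 1

section QCommute

variable {R : Type} [Ring R] [Algebra ℂ R] {x y z : R} {r : ℂ}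

lemma pow_mul_of_qcomm (h : x * y = r • (y * x)) (n : ℕ) : x ^ n * y = r ^ n • (y * x ^ n) := by
  induction n with
  | zero => simp
  | succ n ih =>
    rw [pow_succ', mul_assoc, ih, mul_smul_comm, ← mul_assoc, h, smul_mul_assoc, smul_smul,
      mul_assoc, pow_succ]

lemma mul_pow_of_qcomm (h : x * y = r • (y * x)) (n : ℕ) : x * y ^ n = r ^ n • (y ^ n * x) := by
  induction n with
  | zero => simp
  | succ n ih =>
    rw [pow_succ, ← mul_assoc, ih, smul_mul_assoc, mul_assoc, h, mul_smul_comm, smul_smul,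
      mul_assoc, pow_succ]

lemma qcomm_symm (hr : r ≠ 0) (h : x * y = r • (y * x)) : y * x = r⁻¹ • (x * y) := by
  rw [h, smul_smul, inv_mul_cancel₀ hr, one_smul]

lemma mul_pow_mul_pow_of_qcomm (h : x * y = r • (y * x)) (h' : x * z = r • (z * x)) (m n : ℕ) :
    x * (y ^ m * z ^ n) = r ^ (m + n) • (y ^ m * z ^ n * x) := by
  rw [← mul_assoc, mul_pow_of_qcomm h, smul_mul_assoc, mul_assoc, mul_pow_of_qcomm h',
    mul_smul_comm, smul_smul, pow_add, mul_assoc]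

end QCommute

namespace IsQuantumMat

variable {R : Type} [Ring R] [Algebra ℂ R] {q : ℂ} {a b c d : R}

lemma op (hq : q ≠ 0) (h : IsQuantumMat q a b c d) :
    IsQuantumMat q⁻¹ (MulOpposite.op a) (MulOpposite.op b) (MulOpposite.op c)
      (MulOpposite.op d) where
  ab := MulOpposite.unop_injective (by simpa using qcomm_symm hq h.ab)
  ac := MulOpposite.unop_injective (by simpa using qcomm_symm hq h.ac)
  bd := MulOpposite.unop_injective (by simpa using qcomm_symm hq h.bd)
  cd := MulOpposite.unop_injective (by simpa using qcomm_symm hq h.cd)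
  bc := MulOpposite.unop_injective (by simpa using h.bc.symm)
  ad := MulOpposite.unop_injective (by
    have := h.ad
    simp only [MulOpposite.unop_sub, MulOpposite.unop_mul, MulOpposite.unop_op,
      MulOpposite.unop_smul, inv_inv, ← h.bc]
    rw [← neg_sub, this, ← neg_smul, neg_sub])

variable (h : IsQuantumMat q a b c d)
include h

lemma det_eq : a * d - q • (b * c) = d * a - q⁻¹ • (b * c) := by
  have := h.ad
  rw [sub_smul] at this
  rw [sub_eq_iff_eq_add.1 this]
  abel

lemma mul_bc : a * (b * c) = q ^ 2 • (b * c * a) := by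
  simpa using mul_pow_mul_pow_of_qcomm h.ab h.ac 1 1

lemma commute_det_a (hq : q ≠ 0) : Commute (a * d - q • (b * c)) a := by
  have e : (a * d - q • (b * c)) * a = a * (d * a - q⁻¹ • (b * c)) := by
    have hs : q⁻¹ * q ^ 2 = q := by field_simp
    rw [sub_mul, mul_sub, mul_smul_comm, h.mul_bc, smul_smul, smul_mul_assoc, mul_assoc, hs]
  rw [Commute, SemiconjBy, e, h.det_eq]

lemma commute_det_d (hq : q ≠ 0) : Commute (a * d - q • (b * c)) d := by
  have e : d * (a * d - q • (b * c)) = (d * a - q⁻¹ • (b * c)) * d := by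
    have := mul_pow_mul_pow_of_qcomm (qcomm_symm hq h.bd) (qcomm_symm hq h.cd) 1 1
    simp only [pow_one] at this
    have hs : q * q⁻¹ ^ (1 + 1) = q⁻¹ := by rw [inv_pow]; field_simp
    rw [sub_mul, mul_sub, mul_smul_comm, this, smul_smul, smul_mul_assoc, ← mul_assoc d, hs]
  rw [Commute, SemiconjBy, e, h.det_eq]

lemma commute_det_b (hq : q ≠ 0) : Commute (a * d - q • (b * c)) b := by
  rw [Commute, SemiconjBy, sub_mul, mul_sub, mul_assoc, qcomm_symm hq h.bd, mul_smul_comm,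
    ← mul_assoc, h.ab, smul_mul_assoc, smul_smul, inv_mul_cancel₀ hq, one_smul, mul_assoc,
    smul_mul_assoc, mul_smul_comm, mul_assoc, ← h.bc]

lemma commute_det_c (hq : q ≠ 0) : Commute (a * d - q • (b * c)) c := by
  rw [Commute, SemiconjBy, sub_mul, mul_sub, mul_assoc, qcomm_symm hq h.cd, mul_smul_comm,
    ← mul_assoc, h.ac, smul_mul_assoc, smul_smul, inv_mul_cancel₀ hq, one_smul, mul_assoc,
    smul_mul_assoc, mul_smul_comm, ← mul_assoc c a d, ← mul_assoc c b c, ← h.bc]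

/-- The quantum determinant is central. -/
lemma commute_det (hq : q ≠ 0) (hgen : Algebra.adjoin ℂ {a, b, c, d} = ⊤) (f : R) :
    Commute (a * d - q • (b * c)) f := by
  have hf : f ∈ Algebra.adjoin ℂ {a, b, c, d} := hgen ▸ Algebra.mem_top
  induction hf using Algebra.adjoin_induction with
  | mem x hx =>
    rcases hx with rfl | rfl | rfl | rfl
    exacts [h.commute_det_a hq, h.commute_det_b hq, h.commute_det_c hq, h.commute_det_d hq]
  | algebraMap r => exact (Algebra.commutes r _).symm
  | add x y _ _ hx hy => exact hx.add_right hy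
  | mul x y _ _ hx hy => exact hx.mul_right hy

end IsQuantumMat

namespace IsQuantumSL

variable {R : Type} [Ring R] [Algebra ℂ R] {q : ℂ} {a b c d : R}

lemma op (hq : q ≠ 0) (h : IsQuantumSL q a b c d) :
    IsQuantumSL q⁻¹ (MulOpposite.op a) (MulOpposite.op b) (MulOpposite.op c)
      (MulOpposite.op d) where
  toIsQuantumMat := h.toIsQuantumMat.op hq
  det := MulOpposite.unop_injective (by
    simpa [← h.bc] using h.det_eq.symm.trans h.det)

variable (h : IsQuantumSL q a b c d)
include h

lemma mul_ad : a * d = 1 + q • (b * c) := by rw [← h.det]; abel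

lemma mul_da : d * a = 1 + q⁻¹ • (b * c) := by rw [← h.det, h.det_eq]; abel

lemma d_mul_mul_b (hq : q ≠ 0) (m n j : ℕ) :
    d * (b ^ m * c ^ n * d ^ j) * b = q⁻¹ ^ (m + n + j + 1) • (b ^ (m + 1) * c ^ n * d ^ (j + 1)) := by
  have hdb := qcomm_symm hq h.bd
  have hdc := qcomm_symm hq h.cd
  rw [← mul_assoc d, mul_pow_mul_pow_of_qcomm hdb hdc, smul_mul_assoc, smul_mul_assoc,
    mul_assoc _ d, ← pow_succ', mul_assoc _ _ b, pow_mul_of_qcomm hdb, mul_smul_comm, smul_smul,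
    ← pow_add, ← mul_assoc, mul_assoc _ _ b, ← ((show Commute b c from h.bc).pow_right n).eq,
    ← mul_assoc, ← pow_succ]
  rfl

lemma a_mul_mul_c (m n j : ℕ) :
    a * (b ^ m * c ^ n * a ^ j) * c = q ^ (m + n + j + 1) • (b ^ m * c ^ (n + 1) * a ^ (j + 1)) := by
  rw [← mul_assoc a, mul_pow_mul_pow_of_qcomm h.ab h.ac, smul_mul_assoc, smul_mul_assoc,
    mul_assoc _ a, ← pow_succ', mul_assoc _ _ c, pow_mul_of_qcomm h.ac, mul_smul_comm, smul_smul,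
    ← pow_add, ← mul_assoc, mul_assoc _ _ c, ← pow_succ]
  rfl

omit [Algebra ℂ R] h in
lemma b_mul_mul (m n j : ℕ) :
    b * (b ^ m * c ^ n * d ^ j) * d = b ^ (m + 1) * c ^ n * d ^ (j + 1) := by
  simp only [pow_succ' b, pow_succ d, mul_assoc]

lemma c_mul_mul (m n j : ℕ) :
    c * (b ^ m * c ^ n * a ^ j) * a = b ^ m * c ^ (n + 1) * a ^ (j + 1) := by
  rw [← mul_assoc c, ← mul_assoc c, ← ((show Commute b c from h.bc).pow_left m).eq,
    pow_succ a, pow_succ' c]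
  simp only [mul_assoc]

lemma d_mul_mul_a (hq : q ≠ 0) (m n : ℕ) :
    d * (b ^ m * c ^ n) * a =
      q⁻¹ ^ (m + n) • (b ^ m * c ^ n) + q⁻¹ ^ (m + n + 1) • (b ^ (m + 1) * c ^ (n + 1)) := by
  rw [mul_pow_mul_pow_of_qcomm (qcomm_symm hq h.bd) (qcomm_symm hq h.cd), smul_mul_assoc,
    mul_assoc _ d, h.mul_da, mul_add, mul_one, mul_smul_comm, smul_add, smul_smul, ← pow_succ,
    ← mul_assoc, mul_assoc _ _ b, ← ((show Commute b c from h.bc).pow_right n).eq]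
  simp only [← mul_assoc, ← pow_succ]
  rw [mul_assoc, ← pow_succ]

omit [Algebra ℂ R] h in
lemma b_mul_mul_c (m n : ℕ) : b * (b ^ m * c ^ n) * c = b ^ (m + 1) * c ^ (n + 1) := by
  simp only [pow_succ' b, pow_succ c, mul_assoc]

end IsQuantumSL

section RightIdeal

variable {M : Type} [Ring M] [Algebra ℂ M] {q : ℂ} {a b c d : M}

/-- A subspace containing `1` and stable under right multiplication by generators is everything. -/
lemma Submodule.eq_top_of_mul_right_mem {s : Set M} (hs : Algebra.adjoin ℂ s = ⊤)
    (N : Submodule ℂ M) (h1 : 1 ∈ N) (hN : ∀ f ∈ N, ∀ x ∈ s, f * x ∈ N) : N = ⊤ := by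
  have key : ∀ g : M, ∀ f ∈ N, f * g ∈ N := by
    intro g
    have hg : g ∈ Algebra.adjoin ℂ s := hs ▸ Algebra.mem_top
    induction hg using Algebra.adjoin_induction with
    | mem x hx => exact fun f hf => hN f hf x hx
    | algebraMap r =>
      intro f hf
      rw [← Algebra.commutes, ← Algebra.smul_def]
      exact N.smul_mem r hf
    | add x y _ _ hx hy => exact fun f hf => mul_add f x y ▸ N.add_mem (hx f hf) (hy f hf)
    | mul x y _ _ hx hy => exact fun f hf => mul_assoc f x y ▸ hy _ (hx f hf)
  exact eq_top_iff.2 fun g _ => by simpa using key g 1 h1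

/-- The monomials `aⁱ bʲ` and `aⁱ cʲ⁺¹`. -/
def matMonomial (a b c : M) : (ℕ × ℕ) ⊕ (ℕ × ℕ) → M :=
  Sum.elim (fun p => a ^ p.1 * b ^ p.2) (fun p => a ^ p.1 * c ^ (p.2 + 1))

variable (h : IsQuantumMat q a b c d) (hq : q ≠ 0) (J : Submodule ℂ M)
  (hJ : ∀ f ∈ J, ∀ g, f * g ∈ J) {s τ r : ℂ} (hs : s ≠ 0)
  (hd : a + s • d - algebraMap ℂ M τ ∈ J)
  (hdet : a * d - q • (b * c) - algebraMap ℂ M r ∈ J)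
include h hq hJ hs hd hdet

lemma IsQuantumMat.bc_mem_powers_sup :
    b * c ∈ Submodule.span ℂ (Set.range fun i : ℕ => a ^ i) ⊔ J := by
  set N := Submodule.span ℂ (Set.range fun i : ℕ => a ^ i) ⊔ J with hN
  have ha : ∀ i : ℕ, a ^ i ∈ N := fun i =>
    Submodule.mem_sup_left (Submodule.subset_span ⟨i, rfl⟩)
  have e : b * c = (-q * s⁻¹) • a ^ 2 + (q * s⁻¹ * τ) • a ^ 1 - (q * r) • a ^ 0
      + ((q * s⁻¹) • ((a + s • d - algebraMap ℂ M τ) * a)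
        - q • (a * d - q • (b * c) - algebraMap ℂ M r)) := by
    rw [h.det_eq]
    simp only [add_mul, sub_mul, smul_sub, smul_add, smul_mul_assoc, smul_smul,
      Algebra.algebraMap_eq_smul_one, one_mul, pow_two, pow_one, pow_zero]
    rw [mul_inv_cancel₀ hq, inv_mul_cancel_right₀ hs]
    module
  rw [e]
  exact add_mem (sub_mem (add_mem (N.smul_mem _ (ha 2)) (N.smul_mem _ (ha 1)))
    (N.smul_mem _ (ha 0))) (Submodule.mem_sup_right (sub_mem (J.smul_mem _ (hJ _ hd a))
      (J.smul_mem _ hdet)))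

lemma IsQuantumMat.pow_mul_bc_mem_powers_sup (i : ℕ) :
    a ^ i * (b * c) ∈ Submodule.span ℂ (Set.range fun i : ℕ => a ^ i) ⊔ J := by
  rw [pow_mul_of_qcomm h.mul_bc]
  refine Submodule.smul_mem _ _ ?_
  have key : Submodule.span ℂ (Set.range fun i : ℕ => a ^ i) ⊔ J ≤
      (Submodule.span ℂ (Set.range fun i : ℕ => a ^ i) ⊔ J).comap
        (LinearMap.mulRight ℂ (a ^ i)) := by
    refine sup_le (Submodule.span_le.2 ?_) fun f hf => Submodule.mem_sup_right (hJ f hf _)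
    rintro _ ⟨k, rfl⟩
    exact Submodule.mem_sup_left (Submodule.subset_span ⟨k + i, pow_add a k i⟩)
  exact key (h.bc_mem_powers_sup hq J hJ hs hd hdet)

lemma IsQuantumMat.pow_mul_d_mem_powers_sup (hgen : Algebra.adjoin ℂ {a, b, c, d} = ⊤) (i : ℕ) :
    a ^ i * d ∈ Submodule.span ℂ (Set.range fun i : ℕ => a ^ i) ⊔ J := by
  set N := Submodule.span ℂ (Set.range fun i : ℕ => a ^ i) ⊔ J with hN
  have ha : ∀ i : ℕ, a ^ i ∈ N := fun i =>
    Submodule.mem_sup_left (Submodule.subset_span ⟨i, rfl⟩)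
  cases i with
  | zero =>
    have e : a ^ 0 * d = (s⁻¹ * τ) • a ^ 0 - s⁻¹ • a ^ 1
        + s⁻¹ • (a + s • d - algebraMap ℂ M τ) := by
      simp only [smul_sub, smul_add, smul_smul, Algebra.algebraMap_eq_smul_one, pow_one, pow_zero,
        one_mul, inv_mul_cancel₀ hs]
      module
    rw [e]
    exact add_mem (sub_mem (N.smul_mem _ (ha 0)) (N.smul_mem _ (ha 1)))
      (Submodule.mem_sup_right (J.smul_mem _ hd))
  | succ i =>
    have e : a ^ (i + 1) * d = (a * d - q • (b * c) - algebraMap ℂ M r) * a ^ i + r • a ^ i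
        + q • (a ^ i * (b * c)) := by
      rw [sub_mul, (h.commute_det hq hgen (a ^ i)).eq, Algebra.algebraMap_eq_smul_one,
        smul_mul_assoc, one_mul, mul_sub, mul_smul_comm, pow_succ, mul_assoc]
      abel
    rw [e]
    exact add_mem (add_mem (Submodule.mem_sup_right (hJ _ hdet _)) (N.smul_mem _ (ha i)))
      (N.smul_mem _ (h.pow_mul_bc_mem_powers_sup hq J hJ hs hd hdet i))

/-- Modulo the right ideal generated by `a + s d - τ` and `det - r`, quantum matrices are spanned
by the monomials `aⁱ bʲ` and `aⁱ cʲ⁺¹`. -/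
lemma IsQuantumMat.span_matMonomial_sup (hgen : Algebra.adjoin ℂ {a, b, c, d} = ⊤) :
    Submodule.span ℂ (Set.range (matMonomial a b c)) ⊔ J = ⊤ := by
  set N := Submodule.span ℂ (Set.range (matMonomial a b c)) ⊔ J with hN
  have hb : ∀ i j : ℕ, a ^ i * b ^ j ∈ N := fun i j =>
    Submodule.mem_sup_left (Submodule.subset_span ⟨.inl (i, j), rfl⟩)
  have hc : ∀ i j : ℕ, a ^ i * c ^ j ∈ N := fun i j => by
    cases j with
    | zero => simpa using hb i 0
    | succ j => exact Submodule.mem_sup_left (Submodule.subset_span ⟨.inr (i, j), rfl⟩)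
  have hNb : ∀ f ∈ Submodule.span ℂ (Set.range fun i : ℕ => a ^ i) ⊔ J, ∀ j : ℕ,
      f * b ^ j ∈ N := by
    intro f hf j
    have key : Submodule.span ℂ (Set.range fun i : ℕ => a ^ i) ⊔ J ≤
        N.comap (LinearMap.mulRight ℂ (b ^ j)) :=
      sup_le (Submodule.span_le.2 (by rintro _ ⟨i, rfl⟩; exact hb i j))
        fun f hf => Submodule.mem_sup_right (hJ f hf _)
    exact key hf
  have hNc : ∀ f ∈ Submodule.span ℂ (Set.range fun i : ℕ => a ^ i) ⊔ J, ∀ j : ℕ,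
      f * c ^ j ∈ N := by
    intro f hf j
    have key : Submodule.span ℂ (Set.range fun i : ℕ => a ^ i) ⊔ J ≤
        N.comap (LinearMap.mulRight ℂ (c ^ j)) :=
      sup_le (Submodule.span_le.2 (by rintro _ ⟨i, rfl⟩; exact hc i j))
        fun f hf => Submodule.mem_sup_right (hJ f hf _)
    exact key hf
  have hbc := h.pow_mul_bc_mem_powers_sup hq J hJ hs hd hdet
  have had := h.pow_mul_d_mem_powers_sup hq J hJ hs hd hdet hgen
  refine Submodule.eq_top_of_mul_right_mem hgen N (by simpa using hb 0 0) ?_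
  intro f hf x hx
  have key : N ≤ N.comap (LinearMap.mulRight ℂ x) := by
    refine sup_le (Submodule.span_le.2 ?_) fun f hf => Submodule.mem_sup_right (hJ f hf _)
    rintro _ ⟨⟨i, j⟩ | ⟨i, j⟩, rfl⟩
    · change a ^ i * b ^ j * x ∈ N
      rcases hx with rfl | rfl | rfl | rfl
      · rw [mul_assoc, pow_mul_of_qcomm (qcomm_symm hq h.ab), mul_smul_comm, ← mul_assoc,
          ← pow_succ]
        exact N.smul_mem _ (hb _ _)
      · rw [mul_assoc, ← pow_succ]
        exact hb _ _
      · cases j with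
        | zero => simpa using hc i 1
        | succ j =>
          rw [mul_assoc, pow_succ, mul_assoc, ((show Commute b (b * x) from
            (Commute.refl b).mul_right h.bc).pow_left j).eq, ← mul_assoc]
          exact hNb _ (hbc i) j
      · rw [mul_assoc, pow_mul_of_qcomm h.bd, mul_smul_comm, ← mul_assoc]
        exact N.smul_mem _ (hNb _ (had i) j)
    · change a ^ i * c ^ (j + 1) * x ∈ N
      rcases hx with rfl | rfl | rfl | rfl
      · rw [mul_assoc, pow_mul_of_qcomm (qcomm_symm hq h.ac), mul_smul_comm, ← mul_assoc,
          ← pow_succ]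
        exact N.smul_mem _ (hc _ _)
      · rw [pow_succ, mul_assoc, mul_assoc, ← h.bc, ((show Commute c (x * c) from
            (show Commute c x from h.bc.symm).mul_right (Commute.refl c)).pow_left j).eq,
            ← mul_assoc]
        exact hNc _ (hbc i) j
      · rw [mul_assoc, ← pow_succ]
        exact hc _ _
      · rw [mul_assoc, pow_mul_of_qcomm h.cd, mul_smul_comm, ← mul_assoc]
        exact N.smul_mem _ (hNc _ (had i) (j + 1))
  exact key hf

end RightIdeal

/-- The monomials `bⁱ⁺ʲ cⁱ dʲ` and `bⁱ cⁱ⁺ʲ⁺¹ aʲ⁺¹`, a basis of the quantum sphere. -/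
def sphereMonomial {G : Type} [Ring G] (a b c d : G) : (ℕ × ℕ) ⊕ (ℕ × ℕ) → G :=
  Sum.elim (fun p => b ^ (p.1 + p.2) * c ^ p.1 * d ^ p.2)
    (fun p => b ^ p.1 * c ^ (p.1 + p.2 + 1) * a ^ (p.2 + 1))

/-- A linear map intertwining right multiplication by the generators with the right action
`u ◁ x_ij = ∑ₖ ξₖ S(x_ik) u x_kj`, where the antipode is
`S(a) = d`, `S(b) = -s⁻¹ b`, `S(c) = -s c`, `S(d) = a`. -/
structure IsCoorbitMap {M G : Type} [Ring M] [Algebra ℂ M] [Ring G] [Algebra ℂ G]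
    (s ξ₁ ξ₂ : ℂ) (a b c d : M) (a' b' c' d' : G) (β : M →ₗ[ℂ] G) : Prop where
  one : β 1 = 1
  mul_a (f : M) : β (f * a) = ξ₁ • (d' * β f * a') - (s⁻¹ * ξ₂) • (b' * β f * c')
  mul_b (f : M) : β (f * b) = ξ₁ • (d' * β f * b') - (s⁻¹ * ξ₂) • (b' * β f * d')
  mul_c (f : M) : β (f * c) = ξ₂ • (a' * β f * c') - (s * ξ₁) • (c' * β f * a')
  mul_d (f : M) : β (f * d) = ξ₂ • (a' * β f * d') - (s * ξ₁) • (c' * β f * b')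

namespace IsCoorbitMap

variable {M G : Type} [Ring M] [Algebra ℂ M] [Ring G] [Algebra ℂ G]
  {q s ξ₁ ξ₂ : ℂ} {a b c d : M} {a' b' c' d' : G} {β : M →ₗ[ℂ] G}

/-- Elements of `ℂ[a]` mapped by the co-orbit map to the powers of `b c`. -/
def powersLift (q s ξ₁ ξ₂ : ℂ) (a : M) : ℕ → M
  | 0 => 1
  | i + 1 => (q⁻¹ ^ (2 * i + 1) * (ξ₁ - s⁻¹ * q ^ (2 * i + 1) * ξ₂))⁻¹ •
      (powersLift q s ξ₁ ξ₂ a i * a - (ξ₁ * q⁻¹ ^ (2 * i)) • powersLift q s ξ₁ ξ₂ a i)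

lemma pow_mem_span_powersLift (hq : q ≠ 0)
    (hξ : ∀ n : ℕ, ξ₁ - s⁻¹ * q ^ (2 * n + 1) * ξ₂ ≠ 0) (i : ℕ) :
    a ^ i ∈ Submodule.span ℂ (Set.range (powersLift q s ξ₁ ξ₂ a)) := by
  set N := Submodule.span ℂ (Set.range (powersLift q s ξ₁ ξ₂ a)) with hN
  have hw : ∀ i, powersLift q s ξ₁ ξ₂ a i ∈ N := fun i => Submodule.subset_span ⟨i, rfl⟩
  have key : N ≤ N.comap (LinearMap.mulRight ℂ a) := by
    refine Submodule.span_le.2 ?_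
    rintro _ ⟨i, rfl⟩
    have hne := mul_ne_zero (pow_ne_zero (2 * i + 1) (inv_ne_zero hq)) (hξ i)
    have e : powersLift q s ξ₁ ξ₂ a i * a =
        (q⁻¹ ^ (2 * i + 1) * (ξ₁ - s⁻¹ * q ^ (2 * i + 1) * ξ₂)) • powersLift q s ξ₁ ξ₂ a (i + 1)
          + (ξ₁ * q⁻¹ ^ (2 * i)) • powersLift q s ξ₁ ξ₂ a i := by
      rw [powersLift, smul_smul, mul_inv_cancel₀ hne, one_smul, sub_add_cancel]
    change powersLift q s ξ₁ ξ₂ a i * a ∈ N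
    rw [e]
    exact add_mem (N.smul_mem _ (hw _)) (N.smul_mem _ (hw _))
  induction i with
  | zero => exact pow_zero a ▸ hw 0
  | succ i ih => exact pow_succ a i ▸ key ih

section

variable (hβ : IsCoorbitMap s ξ₁ ξ₂ a b c d a' b' c' d' β) (hG : IsQuantumSL q a' b' c' d')
  (hq : q ≠ 0) (hs : s ≠ 0) (hξ : ∀ n : ℕ, ξ₁ - s⁻¹ * q ^ (2 * n + 1) * ξ₂ ≠ 0)
include hβ hG hq hξ

lemma map_powersLift (i : ℕ) : β (powersLift q s ξ₁ ξ₂ a i) = b' ^ i * c' ^ i := by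
  induction i with
  | zero => simpa [powersLift] using hβ.one
  | succ i ih =>
    have hne := mul_ne_zero (pow_ne_zero (2 * i + 1) (inv_ne_zero hq)) (hξ i)
    have hqq : q⁻¹ ^ (2 * i + 1) * q ^ (2 * i + 1) = 1 := by
      rw [← mul_pow, inv_mul_cancel₀ hq, one_pow]
    rw [powersLift, map_smul, map_sub, hβ.mul_a, map_smul, ih, hG.d_mul_mul_a hq,
      IsQuantumSL.b_mul_mul_c, ← two_mul, inv_smul_eq_iff₀ hne]
    have e : q⁻¹ ^ (2 * i + 1) * (ξ₁ - s⁻¹ * q ^ (2 * i + 1) * ξ₂) =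
        q⁻¹ ^ (2 * i + 1) * ξ₁ - s⁻¹ * ξ₂ := by
      linear_combination (-s⁻¹ * ξ₂) * hqq
    rw [e]
    module

lemma map_powersLift_mul_b (i j : ℕ) : ∃ u : ℂ, u ≠ 0 ∧
    β (powersLift q s ξ₁ ξ₂ a i * b ^ j) = u • (b' ^ (i + j) * c' ^ i * d' ^ j) := by
  induction j with
  | zero => exact ⟨1, one_ne_zero, by simpa using hβ.map_powersLift hG hq hξ i⟩
  | succ j ih =>
    obtain ⟨u, hu, e⟩ := ih
    have hqq : q⁻¹ ^ (2 * (i + j) + 1) * q ^ (2 * (i + j) + 1) = 1 := by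
      rw [← mul_pow, inv_mul_cancel₀ hq, one_pow]
    refine ⟨u * (q⁻¹ ^ (2 * (i + j) + 1) * (ξ₁ - s⁻¹ * q ^ (2 * (i + j) + 1) * ξ₂)),
      mul_ne_zero hu (mul_ne_zero (pow_ne_zero _ (inv_ne_zero hq)) (hξ _)), ?_⟩
    rw [pow_succ, ← mul_assoc, hβ.mul_b, e, mul_smul_comm, smul_mul_assoc, mul_smul_comm,
      smul_mul_assoc, hG.d_mul_mul_b hq, IsQuantumSL.b_mul_mul,
      show i + j + i + j + 1 = 2 * (i + j) + 1 by ring, ← add_assoc]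
    have e' : q⁻¹ ^ (2 * (i + j) + 1) * (ξ₁ - s⁻¹ * q ^ (2 * (i + j) + 1) * ξ₂) =
        q⁻¹ ^ (2 * (i + j) + 1) * ξ₁ - s⁻¹ * ξ₂ := by
      linear_combination (-s⁻¹ * ξ₂) * hqq
    rw [e']
    module

include hs in
lemma map_powersLift_mul_c (i j : ℕ) : ∃ u : ℂ, u ≠ 0 ∧
    β (powersLift q s ξ₁ ξ₂ a i * c ^ j) = u • (b' ^ i * c' ^ (i + j) * a' ^ j) := by
  induction j with
  | zero => exact ⟨1, one_ne_zero, by simpa using hβ.map_powersLift hG hq hξ i⟩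
  | succ j ih =>
    obtain ⟨u, hu, e⟩ := ih
    refine ⟨u * (-s * (ξ₁ - s⁻¹ * q ^ (2 * (i + j) + 1) * ξ₂)),
      mul_ne_zero hu (mul_ne_zero (neg_ne_zero.2 hs) (hξ _)), ?_⟩
    rw [pow_succ, ← mul_assoc, hβ.mul_c, e, mul_smul_comm, smul_mul_assoc, mul_smul_comm,
      smul_mul_assoc, hG.a_mul_mul_c, hG.c_mul_mul,
      show i + (i + j) + j + 1 = 2 * (i + j) + 1 by ring, ← add_assoc]
    have e' : -s * (ξ₁ - s⁻¹ * q ^ (2 * (i + j) + 1) * ξ₂) =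
        q ^ (2 * (i + j) + 1) * ξ₂ - s * ξ₁ := by
      linear_combination (ξ₂ * q ^ (2 * (i + j) + 1)) * mul_inv_cancel₀ hs
    rw [e']
    module

include hs in
lemma exists_lift : ∃ w : (ℕ × ℕ) ⊕ (ℕ × ℕ) → M,
    (∀ p, β (w p) = sphereMonomial a' b' c' d' p) ∧
    ∀ p, matMonomial a b c p ∈ Submodule.span ℂ (Set.range w) := by
  choose u hu eu using hβ.map_powersLift_mul_b hG hq hξ
  choose v hv ev using hβ.map_powersLift_mul_c hG hq hs hξ
  set w : (ℕ × ℕ) ⊕ (ℕ × ℕ) → M :=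
    Sum.elim (fun p => (u p.1 p.2)⁻¹ • (powersLift q s ξ₁ ξ₂ a p.1 * b ^ p.2))
      (fun p => (v p.1 (p.2 + 1))⁻¹ • (powersLift q s ξ₁ ξ₂ a p.1 * c ^ (p.2 + 1))) with hw
  refine ⟨w, ?_, ?_⟩
  · rintro (⟨i, j⟩ | ⟨i, j⟩)
    · simp [w, sphereMonomial, eu, smul_smul, hu]
    · simp [w, sphereMonomial, ev, smul_smul, hv, add_assoc]
  · have key : ∀ x : M, (∀ i, powersLift q s ξ₁ ξ₂ a i * x ∈ Submodule.span ℂ (Set.range w)) →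
        ∀ i, a ^ i * x ∈ Submodule.span ℂ (Set.range w) := by
      intro x hx i
      have hle : Submodule.span ℂ (Set.range (powersLift q s ξ₁ ξ₂ a)) ≤
          (Submodule.span ℂ (Set.range w)).comap (LinearMap.mulRight ℂ x) :=
        Submodule.span_le.2 (by rintro _ ⟨k, rfl⟩; exact hx k)
      exact hle (pow_mem_span_powersLift hq hξ i)
    rintro (⟨i, j⟩ | ⟨i, j⟩)
    · refine key _ (fun k => ?_) i
      have := Submodule.smul_mem _ (u k j)
        (Submodule.subset_span (R := ℂ) (Set.mem_range_self (f := w) (.inl (k, j))))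
      simpa [w, smul_smul, hu] using this
    · refine key _ (fun k => ?_) i
      have := Submodule.smul_mem _ (v k (j + 1))
        (Submodule.subset_span (R := ℂ) (Set.mem_range_self (f := w) (.inr (k, j))))
      simpa [w, smul_smul, hv] using this

end

variable (hβ : IsCoorbitMap s ξ₁ ξ₂ a b c d a' b' c' d' β)
include hβ

lemma ker_mul_mem (hgen : Algebra.adjoin ℂ {a, b, c, d} = ⊤) (f : M) (hf : β f = 0) (g : M) :
    β (f * g) = 0 := by
  have hg : g ∈ Algebra.adjoin ℂ {a, b, c, d} := hgen ▸ Algebra.mem_top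
  induction hg using Algebra.adjoin_induction generalizing f with
  | mem x hx =>
    rcases hx with rfl | rfl | rfl | rfl
    · simp [hβ.mul_a, hf]
    · simp [hβ.mul_b, hf]
    · simp [hβ.mul_c, hf]
    · simp [hβ.mul_d, hf]
  | algebraMap r => rw [← Algebra.commutes, ← Algebra.smul_def, map_smul, hf, smul_zero]
  | add x y _ _ hx hy => rw [mul_add, map_add, hx f hf, hy f hf, add_zero]
  | mul x y _ _ hx hy => rw [← mul_assoc]; exact hy _ (hx f hf)

variable (hG : IsQuantumSL q a' b' c' d') (hq : q ≠ 0) (hs : s ≠ 0)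
include hG hq hs

lemma map_trace : β (a + (q * s)⁻¹ • d - algebraMap ℂ M (ξ₁ + (q * s)⁻¹ * ξ₂)) = 0 := by
  have ha := hβ.mul_a 1
  have hd := hβ.mul_d 1
  rw [one_mul, hβ.one, mul_one, mul_one] at ha hd
  rw [map_sub, map_add, map_smul, ha, hd, Algebra.algebraMap_eq_smul_one, map_smul, hβ.one,
    hG.mul_ad, hG.mul_da, ← hG.bc]
  have e1 : (q * s)⁻¹ * s = q⁻¹ := by field_simp
  have e2 : (q * s)⁻¹ * q = s⁻¹ := by field_simp
  rw [← e1, ← e2]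
  module

lemma map_det : β (a * d - q • (b * c) - algebraMap ℂ M (ξ₁ * ξ₂)) = 0 := by
  have ha := hβ.mul_a 1
  have hb := hβ.mul_b 1
  rw [one_mul, hβ.one, mul_one, mul_one] at ha hb
  have h1 : a' * (d' * a') * d' = (1 + q • (b' * c')) * (1 + q • (b' * c')) := by
    rw [← hG.mul_ad]; simp only [mul_assoc]
  have h2 : a' * (b' * c') * d' = q • (a' * (b' * d') * c') := by
    rw [mul_assoc, mul_assoc, hG.cd, mul_smul_comm, mul_smul_comm]; simp only [mul_assoc]
  have h3 : c' * (d' * a') * b' = q • (c' * (d' * b') * a') := by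
    rw [mul_assoc, mul_assoc, hG.ab, mul_smul_comm, mul_smul_comm]; simp only [mul_assoc]
  have h4 : a' * (d' * b') * c' = (1 + q • (b' * c')) * (b' * c') := by
    rw [← hG.mul_ad]; simp only [mul_assoc]
  have h5 : c' * (b' * d') * a' = (b' * c') * (1 + q⁻¹ • (b' * c')) := by
    rw [← hG.mul_da, hG.bc]; simp only [mul_assoc]
  have h6 : c' * (b' * c') * b' = (b' * c') * (b' * c') := by
    rw [show c' * (b' * c') * b' = (c' * b') * (c' * b') by simp only [mul_assoc], ← hG.bc]
  have e1 : s * s⁻¹ = 1 := mul_inv_cancel₀ hs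
  have e2 : q * q⁻¹ = 1 := mul_inv_cancel₀ hq
  rw [map_sub, map_sub, map_smul, hβ.mul_d, hβ.mul_c, ha, hb, Algebra.algebraMap_eq_smul_one,
    map_smul, hβ.one]
  simp only [mul_sub, sub_mul, mul_smul_comm, smul_mul_assoc, h1, h2, h3, h4, h5, h6, mul_add,
    add_mul, mul_one, one_mul, smul_add, smul_sub, smul_smul]
  match_scalars
  · ring
  · linear_combination (-ξ₁ * ξ₂ * q) * e1
  · linear_combination (-ξ₁ * ξ₂ * s * s⁻¹) * e2
  · ring
  · ring

variable (hM : IsQuantumMat q a b c d) (hgen : Algebra.adjoin ℂ {a, b, c, d} = ⊤)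
  (hξ : ∀ n : ℕ, ξ₁ - s⁻¹ * q ^ (2 * n + 1) * ξ₂ ≠ 0)
include hM hgen hξ

lemma exists_eq_sum_add {J : Submodule ℂ M} (hJ : ∀ f ∈ J, ∀ g, f * g ∈ J)
    (ht : a + (q * s)⁻¹ • d - algebraMap ℂ M (ξ₁ + (q * s)⁻¹ * ξ₂) ∈ J)
    (hdet : a * d - q • (b * c) - algebraMap ℂ M (ξ₁ * ξ₂) ∈ J) (f : M) :
    ∃ (l : ((ℕ × ℕ) ⊕ (ℕ × ℕ)) →₀ ℂ) (g w : M), g ∈ J ∧ f = w + g ∧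
      β w = Finsupp.linearCombination ℂ (sphereMonomial a' b' c' d') l ∧ (l = 0 → w = 0) := by
  obtain ⟨w, hw, hmon⟩ := hβ.exists_lift hG hq hs hξ
  have htop := hM.span_matMonomial_sup hq J hJ (inv_ne_zero (mul_ne_zero hq hs)) ht hdet hgen
  have hle : Submodule.span ℂ (Set.range (matMonomial a b c)) ≤ Submodule.span ℂ (Set.range w) :=
    Submodule.span_le.2 (by rintro _ ⟨p, rfl⟩; exact hmon p)
  have hf : f ∈ Submodule.span ℂ (Set.range w) ⊔ J :=
    sup_le_sup_right hle J (htop ▸ Submodule.mem_top)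
  obtain ⟨y, hy, g, hg, rfl⟩ := Submodule.mem_sup.1 hf
  obtain ⟨l, rfl⟩ := (Finsupp.mem_span_range_iff_exists_finsupp).1 hy
  refine ⟨l, g, _, hg, rfl, ?_, ?_⟩
  · simp [Finsupp.sum, Finsupp.linearCombination_apply, hw]
  · rintro rfl
    simp

lemma mem_of_map_eq_zero (hE : LinearIndependent ℂ (sphereMonomial a' b' c' d'))
    {J : Submodule ℂ M} (hJ : ∀ f ∈ J, ∀ g, f * g ∈ J)
    (ht : a + (q * s)⁻¹ • d - algebraMap ℂ M (ξ₁ + (q * s)⁻¹ * ξ₂) ∈ J)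
    (hdet : a * d - q • (b * c) - algebraMap ℂ M (ξ₁ * ξ₂) ∈ J)
    (hJβ : J ≤ LinearMap.ker β) {f : M} (hf : β f = 0) : f ∈ J := by
  obtain ⟨l, g, w, hg, rfl, hw, hl⟩ :=
    hβ.exists_eq_sum_add hG hq hs hM hgen hξ hJ ht hdet f
  rw [map_add, LinearMap.mem_ker.1 (hJβ hg), add_zero, hw] at hf
  rw [hl (linearIndependent_iff.1 hE l hf), zero_add]
  exact hg

/-- The kernel of a co-orbit map is the right ideal generated by the two basic coinvariants
shifted by their values. -/
theorem ker_eq (hE : LinearIndependent ℂ (sphereMonomial a' b' c' d')) :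
    LinearMap.ker β = Submodule.span ℂ {y : M | ∃ h : M,
      y = (a + (q * s)⁻¹ • d - algebraMap ℂ M (ξ₁ + (q * s)⁻¹ * ξ₂)) * h ∨
      y = (a * d - q • (b * c) - algebraMap ℂ M (ξ₁ * ξ₂)) * h} := by
  set S : Set M := {y : M | ∃ h : M,
      y = (a + (q * s)⁻¹ • d - algebraMap ℂ M (ξ₁ + (q * s)⁻¹ * ξ₂)) * h ∨
      y = (a * d - q • (b * c) - algebraMap ℂ M (ξ₁ * ξ₂)) * h} with hS
  have hle : Submodule.span ℂ S ≤ LinearMap.ker β := by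
    refine Submodule.span_le.2 ?_
    rintro _ ⟨h, rfl | rfl⟩
    · exact hβ.ker_mul_mem hgen _ (hβ.map_trace hG hq hs) h
    · exact hβ.ker_mul_mem hgen _ (hβ.map_det hG hq hs) h
  have hideal : ∀ f ∈ Submodule.span ℂ S, ∀ g, f * g ∈ Submodule.span ℂ S := by
    intro f hf g
    have key : Submodule.span ℂ S ≤ (Submodule.span ℂ S).comap (LinearMap.mulRight ℂ g) := by
      refine Submodule.span_le.2 ?_
      rintro _ ⟨h, rfl | rfl⟩
      · exact Submodule.subset_span ⟨h * g, .inl (mul_assoc _ _ _)⟩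
      · exact Submodule.subset_span ⟨h * g, .inr (mul_assoc _ _ _)⟩
    exact key hf
  refine le_antisymm (fun f hf => ?_) hle
  exact hβ.mem_of_map_eq_zero hG hq hs hM hgen hξ hE hideal
    (Submodule.subset_span ⟨1, .inl (mul_one _).symm⟩)
    (Submodule.subset_span ⟨1, .inr (mul_one _).symm⟩) hle hf

theorem range_eq : LinearMap.range β = Submodule.span ℂ (Set.range (sphereMonomial a' b' c' d')) := by
  apply le_antisymm
  · rintro _ ⟨f, rfl⟩
    have hJ : ∀ g ∈ LinearMap.ker β, ∀ h, g * h ∈ LinearMap.ker β :=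
      fun g hg h => hβ.ker_mul_mem hgen g hg h
    obtain ⟨l, g, w, hg, rfl, hw, -⟩ := hβ.exists_eq_sum_add hG hq hs hM hgen hξ hJ
      (hβ.map_trace hG hq hs) (hβ.map_det hG hq hs) f
    rw [map_add, LinearMap.mem_ker.1 hg, add_zero, hw]
    exact Finsupp.mem_span_range_iff_exists_finsupp.2 ⟨l, rfl⟩
  · obtain ⟨w, hw, -⟩ := hβ.exists_lift hG hq hs hξ
    exact Submodule.span_le.2 (by rintro _ ⟨p, rfl⟩; exact ⟨w p, hw p⟩)

end IsCoorbitMap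

section Model

/-- The shift `f ↦ ((m, n) ↦ f (m - 1, n))`. -/
def shiftFst : Module.End ℂ (ℤ × ℤ → ℂ) := LinearMap.funLeft ℂ ℂ fun p => (p.1 - 1, p.2)

/-- The shift `f ↦ ((m, n) ↦ f (m, n - 1))`. -/
def shiftSnd : Module.End ℂ (ℤ × ℤ → ℂ) := LinearMap.funLeft ℂ ℂ fun p => (p.1, p.2 - 1)

/-- The scaling by `r ^ (m + n)`. -/
def scaleDeg (r : ℂ) : Module.End ℂ (ℤ × ℤ → ℂ) where
  toFun f p := r ^ (p.1 + p.2) * f p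
  map_add' f g := by ext p; simp [mul_add]
  map_smul' c f := by ext p; simp [mul_left_comm]

/-- The operator completing `scaleDeg q`, `shiftFst`, `shiftSnd` to a matrix of quantum
determinant one. -/
def lowerDeg (q : ℂ) : Module.End ℂ (ℤ × ℤ → ℂ) :=
  scaleDeg q⁻¹ * (1 + q • (shiftFst * shiftSnd))

@[simp] lemma shiftFst_apply (f : ℤ × ℤ → ℂ) (m n : ℤ) : shiftFst f (m, n) = f (m - 1, n) := rfl
@[simp] lemma shiftSnd_apply (f : ℤ × ℤ → ℂ) (m n : ℤ) : shiftSnd f (m, n) = f (m, n - 1) := rfl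
@[simp] lemma scaleDeg_apply (r : ℂ) (f : ℤ × ℤ → ℂ) (m n : ℤ) :
    scaleDeg r f (m, n) = r ^ (m + n) * f (m, n) := rfl
@[simp] lemma lowerDeg_apply (q : ℂ) (f : ℤ × ℤ → ℂ) (m n : ℤ) :
    lowerDeg q f (m, n) = q⁻¹ ^ (m + n) * (f (m, n) + q * f (m - 1, n - 1)) := rfl

lemma isQuantumSL_model {q : ℂ} (hq : q ≠ 0) :
    IsQuantumSL q (scaleDeg q) shiftFst shiftSnd (lowerDeg q) where
  ab := by
    ext f ⟨m, n⟩
    simp [show m + n = (m - 1 + n) + 1 by ring, zpow_add_one₀ hq]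
    ring
  ac := by
    ext f ⟨m, n⟩
    simp [show m + n = (m + (n - 1)) + 1 by ring, zpow_add_one₀ hq]
    ring
  bd := by
    ext f ⟨m, n⟩
    have e : q ^ (m + n) = q ^ (m - 1 + n) * q := by rw [← zpow_add_one₀ hq]; congr 1; ring
    have := zpow_ne_zero (m - 1 + n) hq
    simp only [Module.End.mul_apply, LinearMap.smul_apply, Pi.smul_apply, shiftFst_apply,
      lowerDeg_apply, smul_eq_mul, inv_zpow, e]
    field_simp
  cd := by
    ext f ⟨m, n⟩
    have e : q ^ (m + n) = q ^ (m + (n - 1)) * q := by rw [← zpow_add_one₀ hq]; congr 1; ring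
    have := zpow_ne_zero (m + (n - 1)) hq
    simp only [Module.End.mul_apply, LinearMap.smul_apply, Pi.smul_apply, shiftSnd_apply,
      lowerDeg_apply, smul_eq_mul, inv_zpow, e]
    field_simp
  bc := by
    ext f ⟨m, n⟩
    simp
  ad := by
    ext f ⟨m, n⟩
    have e : q ^ (m + n) = q ^ (m - 1 + (n - 1)) * q * q := by
      rw [← zpow_add_one₀ hq, ← zpow_add_one₀ hq]; congr 1; ring
    have := zpow_ne_zero (m - 1 + (n - 1)) hq
    simp only [Module.End.mul_apply, LinearMap.smul_apply, Pi.smul_apply, shiftFst_apply,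
      shiftSnd_apply, lowerDeg_apply, scaleDeg_apply, smul_eq_mul, inv_zpow, e,
      LinearMap.sub_apply, Pi.sub_apply]
    field_simp
    ring
  det := by
    ext f ⟨m, n⟩
    have := zpow_ne_zero (m + n) hq
    simp only [Module.End.mul_apply, LinearMap.smul_apply, Pi.smul_apply, shiftFst_apply,
      shiftSnd_apply, lowerDeg_apply, scaleDeg_apply, smul_eq_mul, inv_zpow,
      LinearMap.sub_apply, Pi.sub_apply, Module.End.one_apply]
    field_simp
    ring

lemma shiftFst_pow_apply (k : ℕ) (f : ℤ × ℤ → ℂ) (m n : ℤ) :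
    (shiftFst ^ k) f (m, n) = f (m - k, n) := by
  induction k generalizing m with
  | zero => simp
  | succ k ih => rw [pow_succ']; simp [ih, sub_sub, add_comm]

lemma shiftSnd_pow_apply (k : ℕ) (f : ℤ × ℤ → ℂ) (m n : ℤ) :
    (shiftSnd ^ k) f (m, n) = f (m, n - k) := by
  induction k generalizing n with
  | zero => simp
  | succ k ih => rw [pow_succ']; simp [ih, sub_sub, add_comm]

lemma scaleDeg_pow_single (q : ℂ) (k : ℕ) :
    (scaleDeg q ^ k) (Pi.single 0 1) = Pi.single 0 1 := by
  induction k with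
  | zero => simp
  | succ k ih =>
    rw [pow_succ', Module.End.mul_apply, ih]
    ext ⟨m, n⟩
    by_cases h : (m, n) = (0 : ℤ × ℤ)
    · obtain ⟨rfl, rfl⟩ := Prod.mk.inj h
      simp
    · simp [Pi.single_eq_of_ne h]

lemma lowerDeg_pow_single_eq_zero (q : ℂ) (k : ℕ) (m n : ℤ) (h : m ≠ n ∨ n < 0) :
    (lowerDeg q ^ k) (Pi.single 0 1) (m, n) = 0 := by
  induction k generalizing m n with
  | zero =>
    have : (m, n) ≠ (0 : ℤ × ℤ) := by
      intro e
      obtain ⟨rfl, rfl⟩ := Prod.mk.inj e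
      simp at h
    simp [Pi.single_eq_of_ne this]
  | succ k ih =>
    rw [pow_succ', Module.End.mul_apply, lowerDeg_apply, ih m n h, ih (m - 1) (n - 1) (by omega)]
    simp

lemma lowerDeg_pow_single_zero (q : ℂ) (k : ℕ) :
    (lowerDeg q ^ k) (Pi.single 0 1) (0, 0) = 1 := by
  induction k with
  | zero => simp [show ((0 : ℤ), (0 : ℤ)) = 0 from rfl]
  | succ k ih =>
    rw [pow_succ', Module.End.mul_apply, lowerDeg_apply, ih,
      lowerDeg_pow_single_eq_zero q k _ _ (.inr (by norm_num))]
    simp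

lemma linearIndependent_sphereMonomial_model (q : ℂ) :
    LinearIndependent ℂ (sphereMonomial (scaleDeg q) shiftFst shiftSnd (lowerDeg q)) := by
  have hr : ∀ (i j : ℕ) (m n : ℤ), sphereMonomial (scaleDeg q) shiftFst shiftSnd (lowerDeg q)
      (.inr (i, j)) (Pi.single 0 1) (m, n) = if m = i ∧ n = i + j + 1 then 1 else 0 := by
    intro i j m n
    simp only [sphereMonomial, Sum.elim_inr, Module.End.mul_apply, scaleDeg_pow_single,
      shiftFst_pow_apply, shiftSnd_pow_apply, Pi.single_apply, Prod.ext_iff, Prod.fst_zero,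
      Prod.snd_zero, Nat.cast_add, Nat.cast_one, sub_eq_zero]
  have hl : ∀ (i j : ℕ) (m n : ℤ), sphereMonomial (scaleDeg q) shiftFst shiftSnd (lowerDeg q)
      (.inl (i, j)) (Pi.single 0 1) (m, n) =
        (lowerDeg q ^ j) (Pi.single 0 1) (m - (i + j), n - i) := by
    intro i j m n
    simp only [sphereMonomial, Sum.elim_inl, Module.End.mul_apply, shiftFst_pow_apply,
      shiftSnd_pow_apply, Nat.cast_add]
  rw [linearIndependent_iff']
  intro s g hg
  have hev : ∀ m n : ℤ, ∑ p ∈ s, g p * sphereMonomial (scaleDeg q) shiftFst shiftSnd (lowerDeg q)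
      p (Pi.single 0 1) (m, n) = 0 := by
    intro m n
    have := congrFun (LinearMap.congr_fun hg (Pi.single 0 1)) (m, n)
    simpa [LinearMap.sum_apply, Finset.sum_apply] using this
  have hinr : ∀ i j : ℕ, Sum.inr (i, j) ∈ s → g (.inr (i, j)) = 0 := by
    intro i j hs
    have := hev i (i + j + 1)
    rw [Finset.sum_eq_single_of_mem _ hs] at this
    · simpa [hr] using this
    · rintro (⟨i', j'⟩ | ⟨i', j'⟩) - hne
      · rw [hl, lowerDeg_pow_single_eq_zero _ _ _ _ (.inl (by omega)), mul_zero]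
      · rw [hr, if_neg, mul_zero]
        rintro ⟨h1, h2⟩
        exact hne (by congr 2 <;> omega)
  have hinl : ∀ i j : ℕ, Sum.inl (i, j) ∈ s → g (.inl (i, j)) = 0 := by
    intro i
    induction i using Nat.strong_induction_on with
    | _ i ih =>
      intro j hs
      have := hev (i + j) i
      rw [Finset.sum_eq_single_of_mem _ hs] at this
      · simpa [hl, lowerDeg_pow_single_zero] using this
      · rintro (⟨i', j'⟩ | ⟨i', j'⟩) hs' hne
        · by_cases hj : j' = j
          · subst hj
            rcases lt_trichotomy i' i with h | rfl | h
            · rw [ih i' h j' hs', zero_mul]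
            · exact absurd rfl hne
            · rw [hl, lowerDeg_pow_single_eq_zero _ _ _ _ (.inr (by omega)), mul_zero]
          · rw [hl, lowerDeg_pow_single_eq_zero _ _ _ _ (.inl (by omega)), mul_zero]
        · rw [hr, if_neg (by omega), mul_zero]
  rintro (⟨i, j⟩ | ⟨i, j⟩) hp
  exacts [hinl i j hp, hinr i j hp]

end Model

/-- Comultiplication, counit and antipode of a Hopf algebra, unbundled: the antipode reverses
products. -/
lemma antipode_mul_of_hopf {G : Type} [Ring G] [Algebra ℂ G] (Δ : G →ₐ[ℂ] G ⊗[ℂ] G)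
    (ε : G →ₐ[ℂ] ℂ) (S : G →ₗ[ℂ] G)
    (hΔ : (Algebra.TensorProduct.assoc ℂ ℂ ℂ G G G).toAlgHom.comp
      ((Algebra.TensorProduct.map Δ (.id ℂ G)).comp Δ) =
      (Algebra.TensorProduct.map (.id ℂ G) Δ).comp Δ)
    (hl : (Algebra.TensorProduct.map ε (.id ℂ G)).comp Δ =
      (Algebra.TensorProduct.lid ℂ G).symm)
    (hr : (Algebra.TensorProduct.map (.id ℂ G) ε).comp Δ =
      (Algebra.TensorProduct.rid ℂ ℂ G).symm)
    (hS1 : LinearMap.mul' ℂ G ∘ₗ TensorProduct.map S LinearMap.id ∘ₗ Δ.toLinearMap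
      = Algebra.linearMap ℂ G ∘ₗ ε.toLinearMap)
    (hS2 : LinearMap.mul' ℂ G ∘ₗ TensorProduct.map LinearMap.id S ∘ₗ Δ.toLinearMap
      = Algebra.linearMap ℂ G ∘ₗ ε.toLinearMap) :
    S 1 = 1 ∧ ∀ f g, S (f * g) = S g * S f := by
  let _ : Bialgebra ℂ G := Bialgebra.ofAlgHom Δ ε hΔ hl hr
  let _ : HopfAlgebra ℂ G :=
    { antipode := S
      mul_antipode_rTensor_comul := hS1
      mul_antipode_lTensor_comul := hS2 }
  exact ⟨HopfAlgebra.antipode_one, HopfAlgebra.antipode_mul_antidistrib⟩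

/-- The Hopf algebra structure of quantum `GL₂`, with generators the entries `a, b, c, d` of a
quantum matrix and the inverse `e` of its quantum determinant. -/
structure IsQuantumGL {G : Type} [Ring G] [Algebra ℂ G] (q : ℂ) (a b c d e : G)
    (Δ : G →ₐ[ℂ] G ⊗[ℂ] G) (ε : G →ₐ[ℂ] ℂ) (S : G →ₗ[ℂ] G) : Prop
    extends IsQuantumMat q a b c d where
  det_mul : (a * d - q • (b * c)) * e = 1
  mul_det : e * (a * d - q • (b * c)) = 1
  adjoin_eq : Algebra.adjoin ℂ {a, b, c, d, e} = ⊤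
  comul_a : Δ a = a ⊗ₜ a + b ⊗ₜ c
  comul_b : Δ b = a ⊗ₜ b + b ⊗ₜ d
  comul_c : Δ c = c ⊗ₜ a + d ⊗ₜ c
  comul_d : Δ d = c ⊗ₜ b + d ⊗ₜ d
  counit_a : ε a = 1
  counit_b : ε b = 0
  counit_c : ε c = 0
  counit_d : ε d = 1
  antipode_left : LinearMap.mul' ℂ G ∘ₗ TensorProduct.map S LinearMap.id ∘ₗ Δ.toLinearMap
    = Algebra.linearMap ℂ G ∘ₗ ε.toLinearMap
  antipode_right : LinearMap.mul' ℂ G ∘ₗ TensorProduct.map LinearMap.id S ∘ₗ Δ.toLinearMap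
    = Algebra.linearMap ℂ G ∘ₗ ε.toLinearMap

namespace IsQuantumGL

variable {G : Type} [Ring G] [Algebra ℂ G] {q : ℂ} {a b c d e : G}
    {Δ : G →ₐ[ℂ] G ⊗[ℂ] G} {ε : G →ₐ[ℂ] ℂ} {S : G →ₗ[ℂ] G}
    (h : IsQuantumGL q a b c d e Δ ε S)
include h

lemma algHom_ext {R : Type} [Ring R] [Algebra ℂ R] {φ ψ : G →ₐ[ℂ] R}
    (ha : φ a = ψ a) (hb : φ b = ψ b) (hc : φ c = ψ c) (hd : φ d = ψ d) : φ = ψ := by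
  refine AlgHom.ext_of_adjoin_eq_top h.adjoin_eq ?_
  rintro _ (rfl | rfl | rfl | rfl | rfl)
  · exact ha
  · exact hb
  · exact hc
  · exact hd
  · have h1 := congrArg φ h.mul_det
    have h2 := congrArg ψ h.det_mul
    simp only [map_mul, map_sub, map_smul, map_one, ha, hb, hc, hd] at h1 h2
    exact left_inv_eq_right_inv h1 h2

lemma coassoc : (Algebra.TensorProduct.assoc ℂ ℂ ℂ G G G).toAlgHom.comp
    ((Algebra.TensorProduct.map Δ (.id ℂ G)).comp Δ) =
    (Algebra.TensorProduct.map (.id ℂ G) Δ).comp Δ := by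
  refine h.algHom_ext ?_ ?_ ?_ ?_
  all_goals simp [h.comul_a, h.comul_b, h.comul_c, h.comul_d, add_tmul, tmul_add]
  all_goals abel

lemma antipode_mul : S 1 = 1 ∧ ∀ f g, S (f * g) = S g * S f := by
  refine antipode_mul_of_hopf Δ ε S h.coassoc (h.algHom_ext ?_ ?_ ?_ ?_)
    (h.algHom_ext ?_ ?_ ?_ ?_) h.antipode_left h.antipode_right
  all_goals
    simp [h.comul_a, h.comul_b, h.comul_c, h.comul_d, h.counit_a, h.counit_b, h.counit_c,
      h.counit_d]

lemma commute_det (hq : q ≠ 0) (f : G) : Commute (a * d - q • (b * c)) f := by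
  have hf : f ∈ Algebra.adjoin ℂ {a, b, c, d, e} := h.adjoin_eq ▸ Algebra.mem_top
  induction hf using Algebra.adjoin_induction with
  | mem x hx =>
    rcases hx with rfl | rfl | rfl | rfl | rfl
    · exact h.commute_det_a hq
    · exact h.commute_det_b hq
    · exact h.commute_det_c hq
    · exact h.commute_det_d hq
    · exact h.det_mul.trans h.mul_det.symm
  | algebraMap r => exact (Algebra.commutes r _).symm
  | add x y _ _ hx hy => exact hx.add_right hy
  | mul x y _ _ hx hy => exact hx.mul_right hy

lemma commute_detInv (hq : q ≠ 0) (f : G) : Commute e f := by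
  have := h.commute_det hq f
  calc e * f = e * f * ((a * d - q • (b * c)) * e) := by rw [h.det_mul, mul_one]
    _ = e * (f * (a * d - q • (b * c))) * e := by simp only [mul_assoc]
    _ = f * e := by rw [← this.eq, ← mul_assoc, h.mul_det, one_mul]

lemma isQuantumSL (hq : q ≠ 0) : IsQuantumSL q a b (e * c) (e * d) := by
  have he := h.commute_detInv hq
  constructor
  · constructor
    · exact h.ab
    · rw [← mul_assoc, ← he, mul_assoc, h.ac, mul_smul_comm, mul_assoc]
    · rw [← mul_assoc, ← he, mul_assoc, h.bd, mul_smul_comm, mul_assoc]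
    · rw [mul_assoc, mul_assoc, ← mul_assoc c, ← mul_assoc d, ← he c, ← he d, mul_assoc e c,
        mul_assoc e d, h.cd, mul_smul_comm, mul_smul_comm]
    · rw [← mul_assoc, ← he, mul_assoc, h.bc, mul_assoc]
    · rw [← mul_assoc, ← mul_assoc, ← he, ← he b, mul_assoc, mul_assoc, mul_assoc, ← mul_sub, h.ad,
        mul_smul_comm]
  · rw [← mul_assoc, ← mul_assoc, ← he, ← he b, mul_assoc, mul_assoc, ← mul_smul_comm, ← mul_sub,
      h.mul_det]

lemma antipode_eqs (hq : q ≠ 0) : S a = e * d ∧ S b = -(q⁻¹ • (e * b)) ∧ S c = -(q • (e * c)) ∧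
    S d = e * a := by
  have ha := LinearMap.congr_fun h.antipode_left a
  have hb := LinearMap.congr_fun h.antipode_left b
  have hc := LinearMap.congr_fun h.antipode_left c
  have hd := LinearMap.congr_fun h.antipode_left d
  simp only [LinearMap.comp_apply, AlgHom.toLinearMap_apply, h.comul_a, h.comul_b, h.comul_c,
    h.comul_d, map_add, TensorProduct.map_tmul, LinearMap.mul'_apply, LinearMap.id_apply,
    h.counit_a, h.counit_b, h.counit_c, h.counit_d, map_zero] at ha hb hc hd
  have he := h.commute_detInv hq
  have e1 : a * (e * d) - q • (b * (e * c)) = 1 := by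
    rw [← mul_assoc, ← mul_assoc, ← he, ← he b, mul_assoc, mul_assoc, ← mul_smul_comm, ← mul_sub,
      h.mul_det]
  have e2 : c * (e * d) - q • (d * (e * c)) = 0 := by
    rw [← mul_assoc, ← mul_assoc, ← he, ← he d, mul_assoc, mul_assoc, ← mul_smul_comm, ← mul_sub,
      h.cd, sub_self, mul_zero]
  have e3 : b * (e * a) - q⁻¹ • (a * (e * b)) = 0 := by
    rw [← mul_assoc, ← mul_assoc, ← he, ← he a, mul_assoc, mul_assoc, ← mul_smul_comm, ← mul_sub,
      qcomm_symm hq h.ab, sub_self, mul_zero]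
  have e4 : d * (e * a) - q⁻¹ • (c * (e * b)) = 1 := by
    rw [← mul_assoc, ← mul_assoc, ← he, ← he c, mul_assoc, mul_assoc, ← mul_smul_comm, ← mul_sub,
      ← h.bc, ← h.det_eq, h.mul_det]
  refine ⟨?_, ?_, ?_, ?_⟩
  · calc S a = S a * (a * (e * d) - q • (b * (e * c))) + S b * (c * (e * d) - q • (d * (e * c))) := by
          rw [e1, e2]; simp
      _ = (S a * a + S b * c) * (e * d) - q • ((S a * b + S b * d) * (e * c)) := by
          simp only [mul_sub, add_mul, mul_smul_comm, smul_add, mul_assoc]; abel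
      _ = _ := by rw [ha, hb]; simp
  · calc S b = S a * (b * (e * a) - q⁻¹ • (a * (e * b))) + S b * (d * (e * a) - q⁻¹ • (c * (e * b))) := by
          rw [e3, e4]; simp
      _ = (S a * b + S b * d) * (e * a) - q⁻¹ • ((S a * a + S b * c) * (e * b)) := by
          simp only [mul_sub, add_mul, mul_smul_comm, smul_add, mul_assoc]; abel
      _ = _ := by rw [ha, hb]; simp
  · calc S c = S c * (a * (e * d) - q • (b * (e * c))) + S d * (c * (e * d) - q • (d * (e * c))) := by
          rw [e1, e2]; simp
      _ = (S c * a + S d * c) * (e * d) - q • ((S c * b + S d * d) * (e * c)) := by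
          simp only [mul_sub, add_mul, mul_smul_comm, smul_add, mul_assoc]; abel
      _ = _ := by rw [hc, hd]; simp
  · calc S d = S c * (b * (e * a) - q⁻¹ • (a * (e * b))) + S d * (d * (e * a) - q⁻¹ • (c * (e * b))) := by
          rw [e3, e4]; simp
      _ = (S c * b + S d * d) * (e * a) - q⁻¹ • ((S c * a + S d * c) * (e * b)) := by
          simp only [mul_sub, add_mul, mul_smul_comm, smul_add, mul_assoc]; abel
      _ = _ := by rw [hc, hd]; simp

end IsQuantumGL

/-- The monomials `bʲ cᵏ aⁱ` and `bʲ cᵏ dⁱ`, which span quantum `SL₂`. -/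
def slMonomial {G : Type} [Ring G] (a b c d : G) : (ℕ × ℕ × ℕ) ⊕ (ℕ × ℕ × ℕ) → G :=
  Sum.elim (fun p => b ^ p.1 * c ^ p.2.1 * a ^ p.2.2) (fun p => b ^ p.1 * c ^ p.2.1 * d ^ p.2.2)

namespace IsQuantumSL

variable {G : Type} [Ring G] [Algebra ℂ G] {q : ℂ} {a b c d : G} (h : IsQuantumSL q a b c d)
include h

lemma slMonomial_mul_mem (hq : q ≠ 0) (p : (ℕ × ℕ × ℕ) ⊕ (ℕ × ℕ × ℕ)) {x : G}
    (hx : x ∈ ({a, b, c, d} : Set G)) :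
    slMonomial a b c d p * x ∈ Submodule.span ℂ (Set.range (slMonomial a b c d)) := by
  set N := Submodule.span ℂ (Set.range (slMonomial a b c d))
  have hl : ∀ i j k, b ^ j * c ^ k * a ^ i ∈ N := fun i j k =>
    Submodule.subset_span ⟨.inl (j, k, i), rfl⟩
  have hr : ∀ i j k, b ^ j * c ^ k * d ^ i ∈ N := fun i j k =>
    Submodule.subset_span ⟨.inr (j, k, i), rfl⟩
  have hbc : Commute b c := h.bc
  have hb : ∀ (y : G) (r : ℂ) (i j k : ℕ), y * b = r • (b * y) →
      b ^ j * c ^ k * y ^ i * b = r ^ i • (b ^ (j + 1) * c ^ k * y ^ i) := by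
    intro y r i j k hy
    rw [mul_assoc, pow_mul_of_qcomm hy, mul_smul_comm, ← mul_assoc, mul_assoc _ _ b,
      ← (hbc.pow_right k).eq, ← mul_assoc, ← pow_succ]
  have hc : ∀ (y : G) (r : ℂ) (i j k : ℕ), y * c = r • (c * y) →
      b ^ j * c ^ k * y ^ i * c = r ^ i • (b ^ j * c ^ (k + 1) * y ^ i) := by
    intro y r i j k hy
    rw [mul_assoc, pow_mul_of_qcomm hy, mul_smul_comm, ← mul_assoc, mul_assoc _ _ c, ← pow_succ]
  have hdb := qcomm_symm hq h.bd
  have hdc := qcomm_symm hq h.cd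
  have hbcy : ∀ (y : G) (r s : ℂ) (i j k : ℕ), y * b = r • (b * y) → y * c = s • (c * y) →
      b ^ j * c ^ k * y ^ i * (b * c) =
        (r ^ i * s ^ i) • (b ^ (j + 1) * c ^ (k + 1) * y ^ i) := by
    intro y r s i j k h1 h2
    rw [← mul_assoc, hb y r i j k h1, smul_mul_assoc, hc y s i _ k h2, smul_smul]
  rcases p with ⟨j, k, i⟩ | ⟨j, k, i⟩ <;> simp only [slMonomial, Sum.elim_inl, Sum.elim_inr] <;>
    rcases hx with rfl | rfl | rfl | rfl
  · rw [mul_assoc, ← pow_succ]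
    exact hl _ _ _
  · rw [hb _ _ _ _ _ h.ab]
    exact N.smul_mem _ (hl _ _ _)
  · rw [hc _ _ _ _ _ h.ac]
    exact N.smul_mem _ (hl _ _ _)
  · cases i with
    | zero => simpa using hr 1 j k
    | succ i =>
      rw [pow_succ, ← mul_assoc, mul_assoc _ a, h.mul_ad, mul_add, mul_one, mul_smul_comm,
        hbcy _ _ _ _ _ _ h.ab h.ac]
      exact add_mem (hl _ _ _) (N.smul_mem _ (N.smul_mem _ (hl _ _ _)))
  · cases i with
    | zero => simpa using hl 1 j k
    | succ i =>
      rw [pow_succ, ← mul_assoc, mul_assoc _ d, h.mul_da, mul_add, mul_one, mul_smul_comm,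
        hbcy _ _ _ _ _ _ hdb hdc]
      exact add_mem (hr _ _ _) (N.smul_mem _ (N.smul_mem _ (hr _ _ _)))
  · rw [hb _ _ _ _ _ hdb]
    exact N.smul_mem _ (hr _ _ _)
  · rw [hc _ _ _ _ _ hdc]
    exact N.smul_mem _ (hr _ _ _)
  · rw [mul_assoc, ← pow_succ]
    exact hr _ _ _

end IsQuantumSL

namespace IsQuantumGL

variable {G : Type} [Ring G] [Algebra ℂ G] {q : ℂ} {a b c d e : G}
    {Δ : G →ₐ[ℂ] G ⊗[ℂ] G} {ε : G →ₐ[ℂ] ℂ} {S : G →ₗ[ℂ] G}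
    (h : IsQuantumGL q a b c d e Δ ε S)
include h

/-- The quantum determinant as a unit. -/
def detUnit : Gˣ := ⟨a * d - q • (b * c), e, h.det_mul, h.mul_det⟩

lemma span_slMonomial_mul_detUnit (hq : q ≠ 0) :
    Submodule.span ℂ {y : G | ∃ p, ∃ n : ℤ,
      y = slMonomial a b (e * c) (e * d) p * ((h.detUnit ^ n : Gˣ) : G)} = ⊤ := by
  set N := Submodule.span ℂ {y : G | ∃ p, ∃ n : ℤ,
      y = slMonomial a b (e * c) (e * d) p * ((h.detUnit ^ n : Gˣ) : G)}
  have hu : ∀ f : G, Commute (h.detUnit : G) f := h.commute_det hq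
  have hz : ∀ (n : ℤ) (f : G), Commute ((h.detUnit ^ n : Gˣ) : G) f := fun n f =>
    (hu f).units_zpow_left n
  have hz1 : ∀ n : ℤ, ((h.detUnit ^ n : Gˣ) : G) * e = ((h.detUnit ^ (n - 1) : Gˣ) : G) := by
    intro n
    rw [zpow_sub_one]
    rfl
  have hs : ∀ f ∈ Submodule.span ℂ (Set.range (slMonomial a b (e * c) (e * d))), ∀ n : ℤ,
      f * ((h.detUnit ^ n : Gˣ) : G) ∈ N := by
    intro f hf n
    have : Submodule.span ℂ (Set.range (slMonomial a b (e * c) (e * d))) ≤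
        N.comap (LinearMap.mulRight ℂ ((h.detUnit ^ n : Gˣ) : G)) := by
      refine Submodule.span_le.2 ?_
      rintro _ ⟨p, rfl⟩
      exact Submodule.subset_span ⟨p, n, rfl⟩
    exact this hf
  have hSL := h.isQuantumSL hq
  refine Submodule.eq_top_of_mul_right_mem h.adjoin_eq N
    (Submodule.subset_span ⟨.inl (0, 0, 0), 0, by simp [slMonomial]⟩) ?_
  intro f hf x hx
  have : N ≤ N.comap (LinearMap.mulRight ℂ x) := by
    refine Submodule.span_le.2 ?_
    rintro _ ⟨p, n, rfl⟩
    have hc : ((h.detUnit ^ n : Gˣ) : G) = e * ((h.detUnit ^ (n + 1) : Gˣ) : G) := by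
      rw [← (hz _ e).eq, hz1, add_sub_cancel_right]
    change slMonomial a b (e * c) (e * d) p * ((h.detUnit ^ n : Gˣ) : G) * x ∈ N
    rcases hx with rfl | rfl | rfl | rfl | rfl
    · rw [mul_assoc, hz, ← mul_assoc]
      exact hs _ (hSL.slMonomial_mul_mem hq p (by simp)) n
    · rw [mul_assoc, hz, ← mul_assoc]
      exact hs _ (hSL.slMonomial_mul_mem hq p (by simp)) n
    · rw [hc, mul_assoc, mul_assoc, hz, ← mul_assoc e, ← mul_assoc]
      exact hs _ (hSL.slMonomial_mul_mem hq p (by simp)) _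
    · rw [hc, mul_assoc, mul_assoc, hz, ← mul_assoc e, ← mul_assoc]
      exact hs _ (hSL.slMonomial_mul_mem hq p (by simp)) _
    · rw [mul_assoc, hz1]
      exact Submodule.subset_span ⟨p, _, rfl⟩
  exact this hf

end IsQuantumGL

/-- The characters of the torus are distinguished by a linear functional from the trivial one. -/
lemma exists_torus_functional {D : Type} [CommRing D] [Algebra ℂ D] (t : Fin 2 → Dˣ)
    (hfreeD : ∀ (B : Type) [CommRing B] [Algebra ℂ B] (u : Fin 2 → Bˣ),
      ∃! φ : D →ₐ[ℂ] B, ∀ i, φ (t i : D) = (u i : B)) :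
    ∃ p : D →ₗ[ℂ] ℂ, ∀ m n : ℤ, p ((t 0 ^ m * t 1 ^ n : Dˣ) : D) =
      if m = 0 ∧ n = 0 then 1 else 0 := by
  let v : Multiplicative (ℤ × ℤ) →* (AddMonoidAlgebra ℂ (ℤ × ℤ))ˣ :=
    (Units.map (AddMonoidAlgebra.of ℂ (ℤ × ℤ))).comp toUnits.toMonoidHom
  obtain ⟨φ, hφ, -⟩ := hfreeD (AddMonoidAlgebra ℂ (ℤ × ℤ))
    ![v (.ofAdd (1, 0)), v (.ofAdd (0, 1))]
  have h0 : Units.map (φ : D →* AddMonoidAlgebra ℂ (ℤ × ℤ)) (t 0) = v (.ofAdd (1, 0)) :=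
    Units.ext (hφ 0)
  have h1 : Units.map (φ : D →* AddMonoidAlgebra ℂ (ℤ × ℤ)) (t 1) = v (.ofAdd (0, 1)) :=
    Units.ext (hφ 1)
  refine ⟨Finsupp.lapply 0 ∘ₗ (AddMonoidAlgebra.coeffLinearEquiv ℂ).toLinearMap ∘ₗ
    φ.toLinearMap, fun m n => ?_⟩
  have key : φ ((t 0 ^ m * t 1 ^ n : Dˣ) : D) = AddMonoidAlgebra.single (m, n) 1 := by
    change ((Units.map (φ : D →* AddMonoidAlgebra ℂ (ℤ × ℤ)) (t 0 ^ m * t 1 ^ n) :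
      (AddMonoidAlgebra ℂ (ℤ × ℤ))ˣ) : AddMonoidAlgebra ℂ (ℤ × ℤ)) = _
    rw [map_mul, map_zpow, map_zpow, h0, h1, ← map_zpow v, ← map_zpow v, ← map_mul v, ← ofAdd_zsmul,
      ← ofAdd_zsmul, ← ofAdd_add]
    simp [v]
  change (φ ((t 0 ^ m * t 1 ^ n : Dˣ) : D)).coeff 0 = _
  rw [key]
  simp [Finsupp.single_apply, Prod.ext_iff]

section Coinvariants

variable {G D : Type} [Ring G] [Algebra ℂ G] [CommRing D] [Algebra ℂ D]

/-- The coinvariants of a quotient Hopf algebra as a subalgebra. -/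
def coinvSubalgebra (πD : G →ₐ[ℂ] D) (Δ : G →ₐ[ℂ] G ⊗[ℂ] G) : Subalgebra ℂ G :=
  AlgHom.equalizer ((Algebra.TensorProduct.map πD (.id ℂ G)).comp Δ)
    Algebra.TensorProduct.includeRight

lemma span_dCoinv (πD : G →ₐ[ℂ] D) (Δ : G →ₐ[ℂ] G ⊗[ℂ] G) :
    Submodule.span ℂ (dCoinv πD Δ) = Subalgebra.toSubmodule (coinvSubalgebra πD Δ) :=
  Submodule.span_eq (Subalgebra.toSubmodule (coinvSubalgebra πD Δ))

/-- Coinvariants form a right coideal. -/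
lemma comul_mem_of_mem_dCoinv (πD : G →ₐ[ℂ] D) (Δ : G →ₐ[ℂ] G ⊗[ℂ] G)
    (hΔ : (Algebra.TensorProduct.assoc ℂ ℂ ℂ G G G).toAlgHom.comp
      ((Algebra.TensorProduct.map Δ (.id ℂ G)).comp Δ) =
      (Algebra.TensorProduct.map (.id ℂ G) Δ).comp Δ) {f : G} (hf : f ∈ dCoinv πD Δ) :
    Δ f ∈ LinearMap.range (TensorProduct.map (Submodule.span ℂ (dCoinv πD Δ)).subtype
      (LinearMap.id : G →ₗ[ℂ] G)) := by
  have hex : Function.Exact (Submodule.span ℂ (dCoinv πD Δ)).subtype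
      (leftCoact πD Δ - TensorProduct.mk ℂ D G 1) := by
    intro y
    rw [span_dCoinv, LinearMap.sub_apply, sub_eq_zero]
    simp only [Submodule.coe_subtype, Subtype.range_coe_subtype]
    rfl
  refine (Module.Flat.rTensor_exact G hex (Δ f)).1 ?_
  rw [LinearMap.rTensor_sub, LinearMap.sub_apply, sub_eq_zero]
  have e1 : ∀ y : G ⊗[ℂ] G, TensorProduct.assoc ℂ D G G ((leftCoact πD Δ).rTensor G y) =
      TensorProduct.map πD.toLinearMap LinearMap.id
        (Algebra.TensorProduct.assoc ℂ ℂ ℂ G G G (Algebra.TensorProduct.map Δ (.id ℂ G) y)) := by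
    intro y
    induction y with
    | zero => simp
    | add y z hy hz => simp only [map_add, hy, hz]
    | tmul u w =>
      simp only [LinearMap.rTensor_tmul, Algebra.TensorProduct.map_tmul, AlgHom.id_apply, leftCoact,
        LinearMap.comp_apply, AlgHom.toLinearMap_apply]
      induction Δ u with
      | zero => simp
      | add y z hy hz => simp only [map_add, add_tmul, hy, hz]
      | tmul u v => simp
  have e2 : ∀ y : G ⊗[ℂ] G, TensorProduct.assoc ℂ D G G
      ((TensorProduct.mk ℂ D G 1).rTensor G y) = 1 ⊗ₜ y := by
    intro y
    induction y with
    | zero => simp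
    | add y z hy hz => simp only [map_add, tmul_add, hy, hz]
    | tmul u w => simp
  have e3 : ∀ y : G ⊗[ℂ] G, TensorProduct.map πD.toLinearMap LinearMap.id
      (Algebra.TensorProduct.map (.id ℂ G) Δ y) =
        TensorProduct.map LinearMap.id Δ.toLinearMap
          (TensorProduct.map πD.toLinearMap LinearMap.id y) := by
    intro y
    induction y with
    | zero => simp
    | add y z hy hz => simp only [map_add, hy, hz]
    | tmul u w => simp
  apply (TensorProduct.assoc ℂ D G G).injective
  have h1 : Algebra.TensorProduct.assoc ℂ ℂ ℂ G G G
      (Algebra.TensorProduct.map Δ (.id ℂ G) (Δ f)) =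
        Algebra.TensorProduct.map (.id ℂ G) Δ (Δ f) := AlgHom.congr_fun hΔ f
  have h2 : TensorProduct.map πD.toLinearMap LinearMap.id (Δ f) = 1 ⊗ₜ f := hf
  rw [e1, e2, h1, e3, h2]
  simp

end Coinvariants

section Weights

variable {G D : Type} [Ring G] [Algebra ℂ G] [CommRing D] [Algebra ℂ D]

/-- `f` is homogeneous of weight `w` for the left torus coaction. -/
def IsLeftWeight (πD : G →ₐ[ℂ] D) (Δ : G →ₐ[ℂ] G ⊗[ℂ] G) (w : Dˣ) (f : G) : Prop :=
  leftCoact πD Δ f = (w : D) ⊗ₜ f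

variable {πD : G →ₐ[ℂ] D} {Δ : G →ₐ[ℂ] G ⊗[ℂ] G} {v w : Dˣ} {f g : G}

lemma leftCoact_mul : leftCoact πD Δ (f * g) = leftCoact πD Δ f * leftCoact πD Δ g :=
  map_mul ((Algebra.TensorProduct.map πD (.id ℂ G)).comp Δ) f g

lemma leftCoact_one : leftCoact πD Δ 1 = 1 :=
  map_one ((Algebra.TensorProduct.map πD (.id ℂ G)).comp Δ)

lemma isLeftWeight_one : IsLeftWeight πD Δ 1 1 := leftCoact_one

lemma IsLeftWeight.mul (hf : IsLeftWeight πD Δ v f) (hg : IsLeftWeight πD Δ w g) :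
    IsLeftWeight πD Δ (v * w) (f * g) := by
  rw [IsLeftWeight] at *
  rw [leftCoact_mul, hf, hg, Algebra.TensorProduct.tmul_mul_tmul, Units.val_mul]

lemma IsLeftWeight.pow (hf : IsLeftWeight πD Δ v f) (n : ℕ) :
    IsLeftWeight πD Δ (v ^ n) (f ^ n) := by
  induction n with
  | zero => simpa using isLeftWeight_one
  | succ n ih => simpa only [pow_succ] using ih.mul hf

lemma IsLeftWeight.inv {u : Gˣ} (hu : IsLeftWeight πD Δ v u) :
    IsLeftWeight πD Δ v⁻¹ (u⁻¹ : Gˣ) := by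
  rw [IsLeftWeight] at *
  have h1 : leftCoact πD Δ (u⁻¹ : Gˣ) * leftCoact πD Δ u = 1 := by
    rw [← leftCoact_mul, Units.inv_mul, leftCoact_one]
  refine left_inv_eq_right_inv h1 ?_
  rw [hu, Algebra.TensorProduct.tmul_mul_tmul, Units.mul_inv, Units.mul_inv]
  rfl

lemma IsLeftWeight.zpow {u : Gˣ} (hu : IsLeftWeight πD Δ v u) (n : ℤ) :
    IsLeftWeight πD Δ (v ^ n) ((u ^ n : Gˣ) : G) := by
  cases n with
  | ofNat n => simpa using hu.pow n
  | negSucc n =>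
    rw [zpow_negSucc, zpow_negSucc]
    exact IsLeftWeight.inv (by simpa using hu.pow (n + 1))

end Weights

namespace IsQuantumGL

variable {G : Type} [Ring G] [Algebra ℂ G] {q : ℂ} {a b c d e : G}
    {Δ : G →ₐ[ℂ] G ⊗[ℂ] G} {ε : G →ₐ[ℂ] ℂ} {S : G →ₗ[ℂ] G}
    (h : IsQuantumGL q a b c d e Δ ε S)
    {D : Type} [CommRing D] [Algebra ℂ D] {t : Fin 2 → Dˣ} {πD : G →ₐ[ℂ] D}
    (ha : πD a = t 0) (hb : πD b = 0) (hc : πD c = 0) (hd : πD d = t 1)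
include h ha hb hc hd

lemma isLeftWeight_generators : IsLeftWeight πD Δ (t 0) a ∧ IsLeftWeight πD Δ (t 0) b ∧
    IsLeftWeight πD Δ (t 0)⁻¹ (e * c) ∧ IsLeftWeight πD Δ (t 0)⁻¹ (e * d) ∧
    IsLeftWeight πD Δ (t 0 * t 1) h.detUnit := by
  have wa : IsLeftWeight πD Δ (t 0) a := by
    simp [IsLeftWeight, leftCoact, h.comul_a, ha, hb]
  have wb : IsLeftWeight πD Δ (t 0) b := by
    simp [IsLeftWeight, leftCoact, h.comul_b, ha, hb]
  have wc : IsLeftWeight πD Δ (t 1) c := by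
    simp [IsLeftWeight, leftCoact, h.comul_c, hc, hd]
  have wd : IsLeftWeight πD Δ (t 1) d := by
    simp [IsLeftWeight, leftCoact, h.comul_d, hc, hd]
  have wdet : IsLeftWeight πD Δ (t 0 * t 1) h.detUnit := by
    have h1 := wa.mul wd
    have h2 := wb.mul wc
    rw [IsLeftWeight] at *
    change leftCoact πD Δ (a * d - q • (b * c)) = _ ⊗ₜ (a * d - q • (b * c))
    rw [map_sub, map_smul, h1, h2, tmul_sub, tmul_smul]
  have we : IsLeftWeight πD Δ (t 0 * t 1)⁻¹ e := wdet.inv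
  have hw : (t 0 * t 1)⁻¹ * t 1 = (t 0)⁻¹ := by rw [mul_inv, inv_mul_cancel_right]
  exact ⟨wa, wb, hw ▸ we.mul wc, hw ▸ we.mul wd, wdet⟩

lemma sphereMonomial_mem_dCoinv (p : (ℕ × ℕ) ⊕ (ℕ × ℕ)) :
    sphereMonomial a b (e * c) (e * d) p ∈ dCoinv πD Δ := by
  obtain ⟨wa, wb, wc, wd, -⟩ := h.isLeftWeight_generators ha hb hc hd
  rcases p with ⟨i, j⟩ | ⟨i, j⟩
  · have := ((wb.pow (i + j)).mul (wc.pow i)).mul (wd.pow j)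
    have hw : t 0 ^ (i + j) * (t 0)⁻¹ ^ i * (t 0)⁻¹ ^ j = 1 := by
      rw [mul_assoc, ← pow_add, ← mul_pow, mul_inv_cancel, one_pow]
    rw [hw] at this
    exact this
  · have := ((wb.pow i).mul (wc.pow (i + j + 1))).mul (wa.pow (j + 1))
    have hw : t 0 ^ i * (t 0)⁻¹ ^ (i + j + 1) * t 0 ^ (j + 1) = 1 := by
      rw [mul_right_comm, ← pow_add, ← add_assoc, ← mul_pow, mul_inv_cancel, one_pow]
    rw [hw] at this
    exact this

/-- The quantum sphere is spanned by the sphere monomials. -/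
lemma dCoinv_eq (hq : q ≠ 0)
    (hfreeD : ∀ (B : Type) [CommRing B] [Algebra ℂ B] (u : Fin 2 → Bˣ),
      ∃! φ : D →ₐ[ℂ] B, ∀ i, φ (t i : D) = (u i : B)) :
    dCoinv πD Δ = Submodule.span ℂ (Set.range (sphereMonomial a b (e * c) (e * d))) := by
  refine Set.Subset.antisymm ?_ ?_
  · intro f hf
    obtain ⟨p, hp⟩ := exists_torus_functional t hfreeD
    obtain ⟨wa, wb, wc, wd, wdet⟩ := h.isLeftWeight_generators ha hb hc hd
    let P : G →ₗ[ℂ] G := (TensorProduct.lid ℂ G).toLinearMap ∘ₗ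
      TensorProduct.map p LinearMap.id ∘ₗ leftCoact πD Δ
    have hP : ∀ (m n : ℤ) (g : G), IsLeftWeight πD Δ (t 0 ^ m * t 1 ^ n) g →
        P g = (if m = 0 ∧ n = 0 then 1 else 0 : ℂ) • g := by
      intro m n g hg
      change TensorProduct.lid ℂ G (TensorProduct.map p LinearMap.id (leftCoact πD Δ g)) = _
      rw [hg, TensorProduct.map_tmul, TensorProduct.lid_tmul, hp]
      rfl
    set N := Submodule.span ℂ (Set.range (sphereMonomial a b (e * c) (e * d)))
    have hmem : ∀ x ∈ N, ∀ n : ℤ, n = 0 → x * ((h.detUnit ^ n : Gˣ) : G) ∈ N := by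
      rintro x hx n rfl
      simpa using hx
    have key : (⊤ : Submodule ℂ G) ≤ N.comap P := by
      rw [← h.span_slMonomial_mul_detUnit hq]
      refine Submodule.span_le.2 ?_
      rintro _ ⟨(⟨j, k, i⟩ | ⟨j, k, i⟩), n, rfl⟩
      · have w := (((wb.pow j).mul (wc.pow k)).mul (wa.pow i)).mul (wdet.zpow n)
        have hw : t 0 ^ j * (t 0)⁻¹ ^ k * t 0 ^ i * (t 0 * t 1) ^ n =
            t 0 ^ ((j : ℤ) - k + i + n) * t 1 ^ n := by
          simp only [zpow_add, zpow_sub, zpow_natCast, mul_zpow, inv_pow, mul_assoc]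
        rw [hw] at w
        change P (b ^ j * (e * c) ^ k * a ^ i * ((h.detUnit ^ n : Gˣ) : G)) ∈ N
        rw [hP _ _ _ w]
        split_ifs with hz
        · rw [one_smul]
          refine hmem _ ?_ n hz.2
          rcases i with - | i
          · obtain rfl : j = k := by omega
            exact Submodule.subset_span ⟨.inl (j, 0), by simp [sphereMonomial]⟩
          · obtain rfl : k = j + i + 1 := by omega
            exact Submodule.subset_span ⟨.inr (j, i), rfl⟩
        · rw [zero_smul]
          exact N.zero_mem
      · have w := (((wb.pow j).mul (wc.pow k)).mul (wd.pow i)).mul (wdet.zpow n)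
        have hw : t 0 ^ j * (t 0)⁻¹ ^ k * (t 0)⁻¹ ^ i * (t 0 * t 1) ^ n =
            t 0 ^ ((j : ℤ) - k - i + n) * t 1 ^ n := by
          simp only [zpow_add, zpow_sub, zpow_natCast, mul_zpow, inv_pow, mul_assoc]
        rw [hw] at w
        change P (b ^ j * (e * c) ^ k * (e * d) ^ i * ((h.detUnit ^ n : Gˣ) : G)) ∈ N
        rw [hP _ _ _ w]
        split_ifs with hz
        · rw [one_smul]
          refine hmem _ ?_ n hz.2
          obtain rfl : j = k + i := by omega
          exact Submodule.subset_span ⟨.inl (k, i), rfl⟩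
        · rw [zero_smul]
          exact N.zero_mem
    have hfw : IsLeftWeight πD Δ (t 0 ^ (0 : ℤ) * t 1 ^ (0 : ℤ)) f := by
      simpa [IsLeftWeight, dCoinv] using hf
    have := hP 0 0 f hfw
    rw [if_pos ⟨rfl, rfl⟩, one_smul] at this
    exact this ▸ key (Submodule.mem_top (x := f))
  · have : Submodule.span ℂ (Set.range (sphereMonomial a b (e * c) (e * d))) ≤
        Subalgebra.toSubmodule (coinvSubalgebra πD Δ) := by
      refine Submodule.span_le.2 ?_
      rintro _ ⟨p, rfl⟩
      exact h.sphereMonomial_mem_dCoinv ha hb hc hd p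
    exact this

end IsQuantumGL

section Coorbit

variable {M G : Type} [Ring M] [Algebra ℂ M] [Ring G] [Algebra ℂ G] {x : Fin 2 → Fin 2 → M}
  {ΔM : M →ₐ[ℂ] M ⊗[ℂ] M} (hΔM : ∀ i j, ΔM (x i j) = ∑ k, x i k ⊗ₜ[ℂ] x k j) (ι : M →ₐ[ℂ] G)
  {S : G →ₗ[ℂ] G} (hS : ∀ f g, S (f * g) = S g * S f) (ε : M →ₐ[ℂ] ℂ)

include hΔM in
lemma comul_comul_apply (i j : Fin 2) :
    Algebra.TensorProduct.map ΔM (.id ℂ M) (ΔM (x i j)) =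
      ∑ k, ∑ l, (x i l ⊗ₜ[ℂ] x l k) ⊗ₜ[ℂ] x k j := by
  simp only [hΔM, map_sum, Algebra.TensorProduct.map_tmul, AlgHom.id_apply, sum_tmul]

include hΔM hS

lemma coorbit_adjBeta_mul (f : M) (i j : Fin 2) :
    coorbit ε (adjBeta ΔM ι S) (f * x i j) =
      ∑ k, ∑ l, ε (x l k) • (S (ι (x i l)) * coorbit ε (adjBeta ΔM ι S) f * ι (x k j)) := by
  set K : (M ⊗[ℂ] M) ⊗[ℂ] M →ₗ[ℂ] G := (TensorProduct.lid ℂ G).toLinearMap ∘ₗ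
    TensorProduct.map ε.toLinearMap LinearMap.id ∘ₗ
    TensorProduct.map LinearMap.id (LinearMap.mul' ℂ G) ∘ₗ
    (TensorProduct.assoc ℂ M G G).toLinearMap ∘ₗ
    TensorProduct.map
      ((TensorProduct.comm ℂ G M).toLinearMap ∘ₗ
        TensorProduct.map (S ∘ₗ ι.toLinearMap) LinearMap.id)
      ι.toLinearMap with hK
  have hKt : ∀ u v w : M, K ((u ⊗ₜ v) ⊗ₜ w) = ε v • (S (ι u) * ι w) := by
    intro u v w
    simp [hK]
  have hmul : ∀ (T : (M ⊗[ℂ] M) ⊗[ℂ] M) (u v w : M),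
      K (T * ((u ⊗ₜ v) ⊗ₜ w)) = ε v • (S (ι u) * K T * ι w) := by
    intro T u v w
    induction T with
    | zero => simp
    | add y z hy hz => simp only [map_add, add_mul, mul_add, smul_add, hy, hz]
    | tmul y z =>
      induction y with
      | zero => simp
      | add y y' hy hz => simp only [map_add, add_mul, mul_add, smul_add, add_tmul, hy, hz]
      | tmul u' v' =>
        simp only [Algebra.TensorProduct.tmul_mul_tmul, hKt, map_mul, hS, mul_assoc,
          mul_smul_comm, smul_mul_assoc, smul_smul, mul_comm]
  have hco : ∀ g, coorbit ε (adjBeta ΔM ι S) g =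
      K (Algebra.TensorProduct.map ΔM (.id ℂ M) (ΔM g)) := fun g => rfl
  rw [hco, hco, map_mul, map_mul, comul_comul_apply hΔM]
  simp only [Finset.mul_sum, map_sum, hmul]

lemma coorbit_adjAlpha_mul (f : M) (i j : Fin 2) :
    coorbit ε (adjAlpha ΔM ι S) (x i j * f) =
      ∑ k, ∑ l, ε (x l k) • (ι (x k j) * coorbit ε (adjAlpha ΔM ι S) f * S (ι (x i l))) := by
  set K : (M ⊗[ℂ] M) ⊗[ℂ] M →ₗ[ℂ] G := (TensorProduct.lid ℂ G).toLinearMap ∘ₗ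
    TensorProduct.map ε.toLinearMap LinearMap.id ∘ₗ
    TensorProduct.map LinearMap.id (LinearMap.mul' ℂ G) ∘ₗ
    TensorProduct.map LinearMap.id (TensorProduct.comm ℂ G G).toLinearMap ∘ₗ
    (TensorProduct.assoc ℂ M G G).toLinearMap ∘ₗ
    TensorProduct.map
      ((TensorProduct.comm ℂ G M).toLinearMap ∘ₗ
        TensorProduct.map (S ∘ₗ ι.toLinearMap) LinearMap.id)
      ι.toLinearMap with hK
  have hKt : ∀ u v w : M, K ((u ⊗ₜ v) ⊗ₜ w) = ε v • (ι w * S (ι u)) := by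
    intro u v w
    simp [hK]
  have hmul : ∀ (T : (M ⊗[ℂ] M) ⊗[ℂ] M) (u v w : M),
      K (((u ⊗ₜ v) ⊗ₜ w) * T) = ε v • (ι w * K T * S (ι u)) := by
    intro T u v w
    induction T with
    | zero => simp
    | add y z hy hz => simp only [map_add, add_mul, mul_add, smul_add, hy, hz]
    | tmul y z =>
      induction y with
      | zero => simp
      | add y y' hy hz => simp only [map_add, add_mul, mul_add, smul_add, add_tmul, hy, hz]
      | tmul u' v' =>
        simp only [Algebra.TensorProduct.tmul_mul_tmul, hKt, map_mul, hS, mul_assoc,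
          mul_smul_comm, smul_mul_assoc, smul_smul]
  have hco : ∀ g, coorbit ε (adjAlpha ΔM ι S) g =
      K (Algebra.TensorProduct.map ΔM (.id ℂ M) (ΔM g)) := fun g => rfl
  rw [hco, hco, map_mul, map_mul, comul_comul_apply hΔM]
  simp only [Finset.sum_mul, map_sum, hmul]

end Coorbit

section Values

variable {M G : Type} [Ring M] [Algebra ℂ M] [Ring G] [Algebra ℂ G]
  (ΔM : M →ₐ[ℂ] M ⊗[ℂ] M) (ι : M →ₐ[ℂ] G) {S : G →ₗ[ℂ] G} (hS : S 1 = 1) (ε : M →ₐ[ℂ] ℂ)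
include hS

lemma coorbit_adjBeta_one : coorbit ε (adjBeta ΔM ι S) 1 = 1 := by
  simp [coorbit, adjBeta, Algebra.TensorProduct.one_def, hS]

lemma coorbit_adjAlpha_one : coorbit ε (adjAlpha ΔM ι S) 1 = 1 := by
  simp [coorbit, adjAlpha, Algebra.TensorProduct.one_def, hS]

end Values

lemma qdet_fin_two {M : Type} [Ring M] [Algebra ℂ M] (q : ℂ) (x : Fin 2 → Fin 2 → M) :
    qdet q x = x 0 0 * x 1 1 - q • (x 0 1 * x 1 0) := by
  have hf : ∀ hc, ∀ k : Fin 2, (((Finset.univ : Finset (Fin 2)).orderIsoOfFin (k := 2) hc) k).1 =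
      k := by
    intro hc k
    have := Finset.orderEmbOfFin_unique (s := (Finset.univ : Finset (Fin 2))) hc
      (f := id) (fun _ => Finset.mem_univ _) strictMono_id
    exact (congrFun this k).symm
  have hu : (Finset.univ : Finset (Equiv.Perm (Fin 2))) = {1, Equiv.swap 0 1} := by decide
  have h1 : invCount (1 : Equiv.Perm (Fin 2)) = 0 := by decide
  have h2 : invCount (Equiv.swap (0 : Fin 2) 1) = 1 := by decide
  have hc : (Finset.univ : Finset (Fin 2)).card = 2 := rfl
  change ∑ σ : Equiv.Perm (Fin 2), ((-q) ^ invCount σ) • ((List.finRange 2).map fun k =>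
    x (((Finset.univ : Finset (Fin 2)).orderIsoOfFin (k := 2) hc) k).1
      (((Finset.univ : Finset (Fin 2)).orderIsoOfFin (k := 2) hc) (σ k)).1).prod = _
  simp only [hf hc]
  rw [hu, Finset.sum_pair (by decide), h1, h2]
  simp [List.finRange_succ, sub_eq_add_neg]

section Opposite

variable {G : Type} [Ring G] [Algebra ℂ G] {q : ℂ} {a b c d : G}

lemma IsQuantumMat.sphereMonomial_op (h : IsQuantumMat q a b c d) (hq : q ≠ 0)
    (p : (ℕ × ℕ) ⊕ (ℕ × ℕ)) : ∃ u : ℂˣ,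
      sphereMonomial (MulOpposite.op a) (MulOpposite.op b) (MulOpposite.op c) (MulOpposite.op d) p =
        MulOpposite.op (u • sphereMonomial a b c d p) := by
  have hbc : Commute b c := h.bc
  have key : ∀ (y : G) (r : ℂ), r ≠ 0 → y * b = r • (b * y) → y * c = r • (c * y) →
      ∀ i j k : ℕ, ∃ u : ℂˣ, y ^ i * (c ^ k * b ^ j) = u • (b ^ j * c ^ k * y ^ i) := by
    intro y r hr hyb hyc i j k
    refine ⟨(Units.mk0 r hr ^ (j + k)) ^ i, ?_⟩
    rw [← ((hbc.pow_left j).pow_right k).eq,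
      pow_mul_of_qcomm (mul_pow_mul_pow_of_qcomm hyb hyc j k)]
    simp [Units.smul_def]
  rcases p with ⟨i, j⟩ | ⟨i, j⟩
  · obtain ⟨u, hu⟩ := key d q⁻¹ (inv_ne_zero hq) (qcomm_symm hq h.bd) (qcomm_symm hq h.cd) j
      (i + j) i
    exact ⟨u, MulOpposite.unop_injective (by simpa [sphereMonomial] using hu)⟩
  · obtain ⟨u, hu⟩ := key a q hq h.ab h.ac (j + 1) i (i + j + 1)
    exact ⟨u, MulOpposite.unop_injective (by simpa [sphereMonomial] using hu)⟩

lemma IsQuantumMat.linearIndependent_sphereMonomial_op (h : IsQuantumMat q a b c d) (hq : q ≠ 0)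
    (hE : LinearIndependent ℂ (sphereMonomial a b c d)) :
    LinearIndependent ℂ (sphereMonomial (MulOpposite.op a) (MulOpposite.op b) (MulOpposite.op c)
      (MulOpposite.op d)) := by
  choose u hu using h.sphereMonomial_op hq
  have := (hE.units_smul u).map' (MulOpposite.opLinearEquiv ℂ).toLinearMap
    (LinearEquiv.ker _)
  rwa [show sphereMonomial (MulOpposite.op a) (MulOpposite.op b) (MulOpposite.op c)
    (MulOpposite.op d) = (MulOpposite.opLinearEquiv ℂ).toLinearMap ∘
      (u • sphereMonomial a b c d) from funext hu]

lemma IsQuantumMat.span_sphereMonomial_op (h : IsQuantumMat q a b c d) (hq : q ≠ 0) (f : G) :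
    MulOpposite.op f ∈ Submodule.span ℂ (Set.range (sphereMonomial (MulOpposite.op a)
      (MulOpposite.op b) (MulOpposite.op c) (MulOpposite.op d))) ↔
    f ∈ Submodule.span ℂ (Set.range (sphereMonomial a b c d)) := by
  choose u hu using h.sphereMonomial_op hq
  set N := Submodule.span ℂ (Set.range (sphereMonomial a b c d))
  set N' := Submodule.span ℂ (Set.range (sphereMonomial (MulOpposite.op a)
      (MulOpposite.op b) (MulOpposite.op c) (MulOpposite.op d)))
  constructor
  · intro hf
    have : N' ≤ N.comap (MulOpposite.opLinearEquiv ℂ).symm.toLinearMap := by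
      refine Submodule.span_le.2 ?_
      rintro _ ⟨p, rfl⟩
      rw [hu]
      exact N.smul_mem (u p : ℂ) (Submodule.subset_span ⟨p, rfl⟩)
    exact this hf
  · intro hf
    have : N ≤ N'.comap (MulOpposite.opLinearEquiv ℂ).toLinearMap := by
      refine Submodule.span_le.2 ?_
      rintro _ ⟨p, rfl⟩
      have e : MulOpposite.op (sphereMonomial a b c d p) =
          (u p : ℂ)⁻¹ • sphereMonomial (MulOpposite.op a)
            (MulOpposite.op b) (MulOpposite.op c) (MulOpposite.op d) p := by
        rw [hu, MulOpposite.op_smul, Units.smul_def, inv_smul_smul₀ (u p).ne_zero]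
      change MulOpposite.op (sphereMonomial a b c d p) ∈ N'
      rw [e]
      exact N'.smul_mem _ (Submodule.subset_span ⟨p, rfl⟩)
    exact this hf

lemma Submodule.span_op (s : Set G) (f : G) :
    MulOpposite.op f ∈ Submodule.span ℂ (MulOpposite.unop ⁻¹' s) ↔ f ∈ Submodule.span ℂ s := by
  have : Submodule.span ℂ (MulOpposite.unop ⁻¹' s) =
      (Submodule.span ℂ s).map (MulOpposite.opLinearEquiv ℂ).toLinearMap := by
    rw [Submodule.map_span]
    congr 1
    ext y
    exact ⟨fun hy => ⟨_, hy, rfl⟩, by rintro ⟨x, hx, rfl⟩; exact hx⟩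
  rw [this]
  simp

lemma adjoin_op {s : Set G} (hs : Algebra.adjoin ℂ s = ⊤) :
    Algebra.adjoin ℂ (MulOpposite.unop ⁻¹' s) = ⊤ := by
  rw [← Subalgebra.op_adjoin, hs]
  simp

end Opposite

namespace IsQuantumGL

variable {M G : Type} [Ring M] [Algebra ℂ M] [Ring G] [Algebra ℂ G] {q : ℂ}
  {x : Fin 2 → Fin 2 → M} {ι : M →ₐ[ℂ] G} {e : G} {Δ : G →ₐ[ℂ] G ⊗[ℂ] G} {ε : G →ₐ[ℂ] ℂ}
  {S : G →ₗ[ℂ] G}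
  (h : IsQuantumGL q (ι (x 0 0)) (ι (x 0 1)) (ι (x 1 0)) (ι (x 1 1)) e Δ ε S) (hq : q ≠ 0)
  {ΔM : M →ₐ[ℂ] M ⊗[ℂ] M} (hΔM : ∀ i j, ΔM (x i j) = ∑ k, x i k ⊗ₜ[ℂ] x k j)
  {ξ₁ ξ₂ : ℂ} {ev : M →ₐ[ℂ] ℂ} (h00 : ev (x 0 0) = ξ₁) (h01 : ev (x 0 1) = 0)
  (h10 : ev (x 1 0) = 0) (h11 : ev (x 1 1) = ξ₂)
include h hq hΔM h00 h01 h10 h11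

lemma isCoorbitMap_adjBeta : IsCoorbitMap q ξ₁ ξ₂ (x 0 0) (x 0 1) (x 1 0) (x 1 1)
    (ι (x 0 0)) (ι (x 0 1)) (e * ι (x 1 0)) (e * ι (x 1 1)) (coorbit ev (adjBeta ΔM ι S)) := by
  obtain ⟨hSa, hSb, hSc, hSd⟩ := h.antipode_eqs hq
  have he := h.commute_detInv hq
  have e1 : ∀ u v w : G, e * u * v * w = u * v * (e * w) := fun u v w => by
    rw [mul_assoc e, mul_assoc e, (he _).eq, mul_assoc (u * v), (he w).eq]
  constructor
  · exact coorbit_adjBeta_one ΔM ι h.antipode_mul.1 ev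
  all_goals
    intro f
    rw [coorbit_adjBeta_mul hΔM ι h.antipode_mul.2]
    simp only [Fin.sum_univ_two, h00, h01, h10, h11, hSa, hSb, hSc, hSd, zero_smul, add_zero,
      zero_add, neg_mul, smul_mul_assoc, smul_neg, smul_smul, e1, sub_eq_add_neg, mul_comm q⁻¹, zero_mul,
      mul_comm q]
  all_goals abel

lemma isCoorbitMap_adjAlpha : IsCoorbitMap q ξ₁ ξ₂ (MulOpposite.op (x 0 0))
    (MulOpposite.op (x 0 1)) (MulOpposite.op (x 1 0)) (MulOpposite.op (x 1 1))
    (MulOpposite.op (ι (x 0 0))) (MulOpposite.op (ι (x 0 1))) (MulOpposite.op (e * ι (x 1 0)))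
    (MulOpposite.op (e * ι (x 1 1)))
    ((MulOpposite.opLinearEquiv ℂ).toLinearMap ∘ₗ coorbit ev (adjAlpha ΔM ι S) ∘ₗ
      (MulOpposite.opLinearEquiv ℂ).symm.toLinearMap) := by
  obtain ⟨hSa, hSb, hSc, hSd⟩ := h.antipode_eqs hq
  have he := h.commute_detInv hq
  have e1 : ∀ u v w : G, e * u * (v * w) = u * (v * (e * w)) := fun u v w => by
    rw [mul_assoc e, (he _).eq, mul_assoc u, mul_assoc v, (he w).eq]
  constructor
  · exact MulOpposite.unop_injective (coorbit_adjAlpha_one ΔM ι h.antipode_mul.1 ev)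
  all_goals
    intro f
    refine MulOpposite.unop_injective ?_
    simp only [LinearMap.comp_apply, LinearEquiv.coe_coe, MulOpposite.coe_opLinearEquiv,
      MulOpposite.coe_opLinearEquiv_symm, MulOpposite.unop_mul, MulOpposite.unop_op,
      MulOpposite.unop_sub, MulOpposite.unop_smul]
    rw [coorbit_adjAlpha_mul hΔM ι h.antipode_mul.2]
    simp only [Fin.sum_univ_two, h00, h01, h10, h11, hSa, hSb, hSc, hSd, zero_smul, add_zero,
      zero_add, mul_neg, mul_smul_comm, smul_neg, smul_smul, e1, sub_eq_add_neg, mul_comm q⁻¹, zero_mul,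
      mul_comm q, mul_assoc]
  all_goals abel

end IsQuantumGL

lemma range_fin_two_prod {α : Type} (f : Fin 2 → Fin 2 → α) :
    Set.range (fun p : Fin 2 × Fin 2 => f p.1 p.2) = {f 0 0, f 0 1, f 1 0, f 1 1} := by
  ext y
  simp [Fin.exists_fin_two, eq_comm, or_assoc]

section Construction

variable {M G : Type} [Ring M] [Algebra ℂ M] [Ring G] [Algebra ℂ G] {q : ℂ}
  {x : Fin 2 → Fin 2 → M} {ι : M →ₐ[ℂ] G} {e : G}

lemma isQuantumGL_of_generators (hM : IsQuantumMat q (x 0 0) (x 0 1) (x 1 0) (x 1 1))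
    (ι : M →ₐ[ℂ] G) {δ : M} (hδ : δ = x 0 0 * x 1 1 - q • (x 0 1 * x 1 0))
    (hd1 : ι δ * e = 1) (hd2 : e * ι δ = 1)
    (hgenG : Algebra.adjoin ℂ (Set.range (fun p : Fin 2 × Fin 2 => ι (x p.1 p.2)) ∪ {e}) = ⊤)
    {ΔM : M →ₐ[ℂ] M ⊗[ℂ] M} (hΔM : ∀ i j, ΔM (x i j) = ∑ k, x i k ⊗ₜ[ℂ] x k j)
    {Δ : G →ₐ[ℂ] G ⊗[ℂ] G} (hΔ : ∀ m, Δ (ι m) = Algebra.TensorProduct.map ι ι (ΔM m))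
    {ε : G →ₐ[ℂ] ℂ} (hε : ∀ i j, ε (ι (x i j)) = if i = j then 1 else 0) {S : G →ₗ[ℂ] G}
    (hS1 : LinearMap.mul' ℂ G ∘ₗ TensorProduct.map S LinearMap.id ∘ₗ Δ.toLinearMap
      = Algebra.linearMap ℂ G ∘ₗ ε.toLinearMap)
    (hS2 : LinearMap.mul' ℂ G ∘ₗ TensorProduct.map LinearMap.id S ∘ₗ Δ.toLinearMap
      = Algebra.linearMap ℂ G ∘ₗ ε.toLinearMap) :
    IsQuantumGL q (ι (x 0 0)) (ι (x 0 1)) (ι (x 1 0)) (ι (x 1 1)) e Δ ε S where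
  ab := by rw [← map_mul, hM.ab, map_smul, map_mul]
  ac := by rw [← map_mul, hM.ac, map_smul, map_mul]
  bd := by rw [← map_mul, hM.bd, map_smul, map_mul]
  cd := by rw [← map_mul, hM.cd, map_smul, map_mul]
  bc := by rw [← map_mul, hM.bc, map_mul]
  ad := by rw [← map_mul, ← map_mul, ← map_sub, hM.ad, map_smul, map_mul]
  det_mul := by simpa [hδ] using hd1
  mul_det := by simpa [hδ] using hd2
  adjoin_eq := by
    rw [← hgenG, range_fin_two_prod fun i j => ι (x i j)]
    congr 1
    ext y
    simp only [Set.mem_insert_iff, Set.mem_union, Set.mem_singleton_iff, or_assoc]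
  comul_a := by simp [hΔ, hΔM]
  comul_b := by simp [hΔ, hΔM]
  comul_c := by simp [hΔ, hΔM]
  comul_d := by simp [hΔ, hΔM]
  counit_a := by simp [hε]
  counit_b := by simp [hε]
  counit_c := by simp [hε]
  counit_d := by simp [hε]
  antipode_left := hS1
  antipode_right := hS2

lemma linearIndependent_sphereMonomial_of_universal (hq : q ≠ 0) {δ : M}
    (hδ : δ = x 0 0 * x 1 1 - q • (x 0 1 * x 1 0)) (hd1 : ι δ * e = 1)
    (hfree : ∀ (B : Type) [Ring B] [Algebra ℂ B] (y : Fin 2 → Fin 2 → B),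
      (∀ i j l : Fin 2, j < l → y i j * y i l = q • (y i l * y i j)) →
      (∀ i k j : Fin 2, i < k → y i j * y k j = q • (y k j * y i j)) →
      (∀ i k j l : Fin 2, i < k → j < l → y i l * y k j = y k j * y i l) →
      (∀ i k j l : Fin 2, i < k → j < l →
        y i j * y k l - y k l * y i j = (q - q⁻¹) • (y i l * y k j)) →
      ∃! φ : M →ₐ[ℂ] B, ∀ i j, φ (x i j) = y i j)
    (hfreeG : ∀ (B : Type) [Ring B] [Algebra ℂ B] (φ : M →ₐ[ℂ] B) (u : B),
      φ δ * u = 1 → u * φ δ = 1 → ∃! ψ : G →ₐ[ℂ] B, ψ.comp ι = φ) :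
    LinearIndependent ℂ (sphereMonomial (ι (x 0 0)) (ι (x 0 1)) (e * ι (x 1 0))
      (e * ι (x 1 1))) := by
  have hm := isQuantumSL_model hq
  have aux : ∀ i k : Fin 2, i < k → i = 0 ∧ k = 1 := by decide
  obtain ⟨φ, hφ, -⟩ := hfree (Module.End ℂ (ℤ × ℤ → ℂ))
    ![![scaleDeg q, shiftFst], ![shiftSnd, lowerDeg q]]
    (by
      intro i j l hjl
      obtain ⟨rfl, rfl⟩ := aux j l hjl
      fin_cases i
      exacts [hm.ab, hm.cd])
    (by
      intro i k j hik
      obtain ⟨rfl, rfl⟩ := aux i k hik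
      fin_cases j
      exacts [hm.ac, hm.bd])
    (by
      intro i k j l hik hjl
      obtain ⟨rfl, rfl⟩ := aux i k hik
      obtain ⟨rfl, rfl⟩ := aux j l hjl
      exact hm.bc)
    (by
      intro i k j l hik hjl
      obtain ⟨rfl, rfl⟩ := aux i k hik
      obtain ⟨rfl, rfl⟩ := aux j l hjl
      exact hm.ad)
  have ha : φ (x 0 0) = scaleDeg q := hφ 0 0
  have hb : φ (x 0 1) = shiftFst := hφ 0 1
  have hc : φ (x 1 0) = shiftSnd := hφ 1 0
  have hd : φ (x 1 1) = lowerDeg q := hφ 1 1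
  have hφδ : φ δ = 1 := by
    rw [hδ, map_sub, map_smul, map_mul, map_mul, ha, hb, hc, hd, hm.det]
  obtain ⟨ψ, hψ, -⟩ := hfreeG _ φ 1 (by rw [hφδ, mul_one]) (by rw [hφδ, mul_one])
  have hψι : ∀ m, ψ (ι m) = φ m := fun m => DFunLike.congr_fun hψ m
  have hψe : ψ e = 1 := by
    simpa [hψι, hφδ] using congrArg ψ hd1
  refine LinearIndependent.of_comp ψ.toLinearMap ?_
  have hcomp : ψ ∘ sphereMonomial (ι (x 0 0)) (ι (x 0 1)) (e * ι (x 1 0)) (e * ι (x 1 1)) =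
      sphereMonomial (scaleDeg q) shiftFst shiftSnd (lowerDeg q) := by
    funext p
    rcases p with p | p <;> simp [sphereMonomial, hψι, hψe, ha, hb, hc, hd]
  change LinearIndependent ℂ (ψ ∘ _)
  rw [hcomp]
  exact linearIndependent_sphereMonomial_model q

end Construction

/-- `N = 2`, `q` not a root of unity, `ξ = diag(ξ₁, ξ₂)` not a scalar multiple of an
integral power of `diag(q², 1)`: both co-orbit maps surject onto `O(D\GL_q)`, which is
a quantum homogeneous space, and the kernels are the stated one-sided ideals. -/
theorem coorbit_2x2_main
    (q : ℂ) (hq : q ≠ 0) (hqru : (∀ n : ℕ, 0 < n → q ^ n ≠ 1) ∨ q = 1)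
    (M G : Type) [Ring M] [Algebra ℂ M] [Ring G] [Algebra ℂ G]
    (x : Fin 2 → Fin 2 → M)
    (hrow : ∀ i j l : Fin 2, j < l → x i j * x i l = (q) • (x i l * x i j))
    (hcol : ∀ i k j : Fin 2, i < k → x i j * x k j = (q) • (x k j * x i j))
    (hanti : ∀ i k j l : Fin 2, i < k → j < l → x i l * x k j = x k j * x i l)
    (hdiag : ∀ i k j l : Fin 2, i < k → j < l →
      x i j * x k l - x k l * x i j = ((q) - (q⁻¹)) • (x i l * x k j))
    (hgen : Algebra.adjoin ℂ (Set.range fun p : Fin 2 × Fin 2 => x p.1 p.2) = ⊤)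
    (hfree : ∀ (B : Type) [Ring B] [Algebra ℂ B] (y : Fin 2 → Fin 2 → B),
      (∀ i j l : Fin 2, j < l → y i j * y i l = (q) • (y i l * y i j)) →
      (∀ i k j : Fin 2, i < k → y i j * y k j = (q) • (y k j * y i j)) →
      (∀ i k j l : Fin 2, i < k → j < l → y i l * y k j = y k j * y i l) →
      (∀ i k j l : Fin 2, i < k → j < l →
        y i j * y k l - y k l * y i j = ((q) - (q⁻¹)) • (y i l * y k j)) →
      ∃! φ : M →ₐ[ℂ] B, ∀ i j, φ (x i j) = y i j)
    (ι : M →ₐ[ℂ] G) (dInv : G)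
    (hd1 : ι (qdet (q) x) * dInv = 1)
    (hd2 : dInv * ι (qdet (q) x) = 1)
    (hgenG : Algebra.adjoin ℂ
      (Set.range (fun p : Fin 2 × Fin 2 => ι (x p.1 p.2)) ∪ {dInv}) = ⊤)
    (hfreeG : ∀ (B : Type) [Ring B] [Algebra ℂ B] (φ : M →ₐ[ℂ] B) (u : B),
      φ (qdet (q) x) * u = 1 → u * φ (qdet (q) x) = 1 →
      ∃! ψ : G →ₐ[ℂ] B, ψ.comp ι = φ)
    (ΔM : M →ₐ[ℂ] M ⊗[ℂ] M)
    (hΔM : ∀ i j, ΔM (x i j) = ∑ k, x i k ⊗ₜ[ℂ] x k j)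
    (ΔG : G →ₐ[ℂ] G ⊗[ℂ] G)
    (hΔG : ∀ m, ΔG (ι m) = Algebra.TensorProduct.map ι ι (ΔM m))
    (εG : G →ₐ[ℂ] ℂ)
    (hεG : ∀ i j, εG (ι (x i j)) = if i = j then 1 else 0)
    (St : G →ₗ[ℂ] G)
    (hS1 : LinearMap.mul' ℂ G ∘ₗ TensorProduct.map St LinearMap.id ∘ₗ ΔG.toLinearMap
      = Algebra.linearMap ℂ G ∘ₗ εG.toLinearMap)
    (hS2 : LinearMap.mul' ℂ G ∘ₗ TensorProduct.map LinearMap.id St ∘ₗ ΔG.toLinearMap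
      = Algebra.linearMap ℂ G ∘ₗ εG.toLinearMap)
    (D : Type) [CommRing D] [Algebra ℂ D]
    (t : Fin 2 → (D)ˣ)
    (πD : G →ₐ[ℂ] D)
    (hπD : ∀ i j, πD (ι (x i j)) = if i = j then (t i : D) else 0)
    (hfreeD : ∀ (B : Type) [CommRing B] [Algebra ℂ B] (u : Fin 2 → Bˣ),
      ∃! φ : D →ₐ[ℂ] B, ∀ i, φ (t i : D) = (u i : B))
    (ξ1 ξ2 : ℂ) (e : M →ₐ[ℂ] ℂ)
    (he00 : e (x 0 0) = ξ1) (he01 : e (x 0 1) = 0)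
    (he10 : e (x 1 0) = 0) (he11 : e (x 1 1) = ξ2)
    (hnotpow : ¬ ∃ (c : ℂ) (k : ℤ), ξ1 = c * q ^ (2 * k) ∧ ξ2 = c) :
    Set.range ⇑(coorbit e (adjBeta ΔM ι St)) = dCoinv πD ΔG
    ∧ Set.range ⇑(coorbit e (adjAlpha ΔM ι St)) = dCoinv πD ΔG
    ∧ ((1 : G) ∈ dCoinv πD ΔG ∧
        (∀ f g : G, f ∈ dCoinv πD ΔG → g ∈ dCoinv πD ΔG → f * g ∈ dCoinv πD ΔG) ∧
        (∀ f ∈ dCoinv πD ΔG, ΔG f ∈ LinearMap.range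
          (TensorProduct.map (Submodule.span ℂ (dCoinv πD ΔG)).subtype
            (LinearMap.id : G →ₗ[ℂ] G))))
    ∧ LinearMap.ker (coorbit e (adjBeta ΔM ι St))
        = Submodule.span ℂ {y : M | ∃ h : M,
            y = (((q ^ 2)⁻¹ • x 0 0 + (q ^ 4)⁻¹ • x 1 1) - algebraMap ℂ M (e ((q ^ 2)⁻¹ • x 0 0 + (q ^ 4)⁻¹ • x 1 1))) * h ∨
            y = ((x 0 0 * x 1 1 - q • (x 0 1 * x 1 0)) - algebraMap ℂ M (e (x 0 0 * x 1 1 - q • (x 0 1 * x 1 0)))) * h}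
    ∧ LinearMap.ker (coorbit e (adjAlpha ΔM ι St))
        = Submodule.span ℂ {y : M | ∃ h : M,
            y = h * ((x 0 0 + x 1 1) - algebraMap ℂ M (e (x 0 0 + x 1 1))) ∨
            y = h * ((x 0 0 * x 1 1 - q • (x 0 1 * x 1 0)) - algebraMap ℂ M (e (x 0 0 * x 1 1 - q • (x 0 1 * x 1 0))))} := by
  have h01 : (0 : Fin 2) < 1 := Fin.zero_lt_one
  have hM : IsQuantumMat q (x 0 0) (x 0 1) (x 1 0) (x 1 1) :=
    ⟨hrow 0 0 1 h01, hcol 0 1 0 h01, hcol 0 1 1 h01, hrow 1 0 1 h01, hanti 0 1 0 1 h01 h01,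
      hdiag 0 1 0 1 h01 h01⟩
  have hgen' : Algebra.adjoin ℂ {x 0 0, x 0 1, x 1 0, x 1 1} = ⊤ := by
    rw [← hgen, range_fin_two_prod]
  have hdet := qdet_fin_two q x
  have h := isQuantumGL_of_generators hM ι hdet hd1 hd2 hgenG hΔM hΔG hεG hS1 hS2
  have hE := linearIndependent_sphereMonomial_of_universal hq hdet hd1 hfree hfreeG
  have hsl := h.isQuantumSL hq
  have hD := h.dCoinv_eq (t := t) (πD := πD) (by simp [hπD]) (by simp [hπD]) (by simp [hπD])
    (by simp [hπD]) hq hfreeD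
  have hβ := h.isCoorbitMap_adjBeta hq hΔM he00 he01 he10 he11
  have hα := h.isCoorbitMap_adjAlpha hq hΔM he00 he01 he10 he11
  have hξ : ∀ k : ℤ, ξ1 - q ^ (2 * k) * ξ2 ≠ 0 := fun k hk =>
    hnotpow ⟨ξ2, k, by rw [sub_eq_zero.1 hk, mul_comm], rfl⟩
  have hξβ : ∀ n : ℕ, ξ1 - q⁻¹ * q ^ (2 * n + 1) * ξ2 ≠ 0 := fun n => by
    have := hξ n
    rwa [show q ^ (2 * (n : ℤ)) = q⁻¹ * q ^ (2 * n + 1) by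
      rw [pow_succ', inv_mul_cancel_left₀ hq]; rfl] at this
  have hξα : ∀ n : ℕ, ξ1 - q⁻¹ * q⁻¹ ^ (2 * n + 1) * ξ2 ≠ 0 := fun n => by
    have := hξ (-(n + 1))
    rwa [show q ^ (2 * (-((n : ℤ) + 1))) = q⁻¹ * q⁻¹ ^ (2 * n + 1) by
      rw [← pow_succ', inv_pow, ← zpow_natCast, ← zpow_neg]
      exact congrArg _ (by push_cast; ring)] at this
  have hgenop : Algebra.adjoin ℂ {MulOpposite.op (x 0 0), MulOpposite.op (x 0 1),
      MulOpposite.op (x 1 0), MulOpposite.op (x 1 1)} = ⊤ := by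
    rw [← adjoin_op hgen']
    congr 1
    ext y
    simp [← MulOpposite.unop_inj]
  have hMop := hM.op hq
  have hslop := hsl.op hq
  have hq' := inv_ne_zero hq
  have hkβ := hβ.ker_eq hsl hq hq hM hgen' hξβ hE
  have hkα := hα.ker_eq hslop hq' hq hMop hgenop hξα
    (hsl.toIsQuantumMat.linearIndependent_sphereMonomial_op hq hE)
  have hrβ := hβ.range_eq hsl hq hq hM hgen' hξβ
  have hrα := hα.range_eq hslop hq' hq hMop hgenop hξα
  refine ⟨?_, ?_, ⟨?_, ?_, ?_⟩, ?_, ?_⟩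
  · rw [hD, ← hrβ, LinearMap.coe_range]
  · rw [hD]
    ext f
    rw [SetLike.mem_coe, ← hsl.toIsQuantumMat.span_sphereMonomial_op hq, ← hrα]
    constructor
    · rintro ⟨m, rfl⟩
      exact ⟨MulOpposite.op m, rfl⟩
    · rintro ⟨m, hm⟩
      exact ⟨MulOpposite.unop m, congrArg MulOpposite.unop hm⟩
  · exact (coinvSubalgebra πD ΔG).one_mem
  · exact fun f g => (coinvSubalgebra πD ΔG).mul_mem
  · exact fun f => comul_mem_of_mem_dCoinv πD ΔG h.coassoc
  · rw [hkβ]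
    have hτ : (q ^ 2)⁻¹ • x 0 0 + (q ^ 4)⁻¹ • x 1 1 -
        algebraMap ℂ M (e ((q ^ 2)⁻¹ • x 0 0 + (q ^ 4)⁻¹ • x 1 1)) =
        (q ^ 2)⁻¹ • (x 0 0 + (q * q)⁻¹ • x 1 1 - algebraMap ℂ M (ξ1 + (q * q)⁻¹ * ξ2)) := by
      simp only [map_add, map_smul, he00, he11, Algebra.algebraMap_eq_smul_one, smul_eq_mul,
        smul_add, smul_sub, smul_smul]
      rw [show (q ^ 4)⁻¹ = (q ^ 2)⁻¹ * (q * q)⁻¹ by rw [← mul_inv]; ring_nf]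
      module
    have hdet' : e (x 0 0 * x 1 1 - q • (x 0 1 * x 1 0)) = ξ1 * ξ2 := by
      simp [he00, he01, he11]
    rw [hτ, hdet']
    congr 1
    ext y
    constructor
    · rintro ⟨f, rfl | rfl⟩
      · exact ⟨q ^ 2 • f, Or.inl (by
          rw [mul_smul_comm, smul_mul_assoc, smul_inv_smul₀ (pow_ne_zero 2 hq)])⟩
      · exact ⟨f, Or.inr rfl⟩
    · rintro ⟨f, rfl | rfl⟩
      · exact ⟨(q ^ 2)⁻¹ • f, Or.inl (by rw [mul_smul_comm, smul_mul_assoc])⟩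
      · exact ⟨f, Or.inr rfl⟩
  · ext f
    have hf := SetLike.ext_iff.1 hkα (MulOpposite.op f)
    rw [← Submodule.span_op]
    refine Iff.trans (MulOpposite.op_eq_zero_iff _).symm (hf.trans (iff_of_eq ?_))
    congr 3
    ext y
    have hdet' : e (x 0 0 * x 1 1 - q • (x 0 1 * x 1 0)) = ξ1 * ξ2 := by
      simp [he00, he01, he11]
    simp only [Set.mem_ofPred_eq]
    rw [hdet', hM.det_eq, hM.bc,
      MulOpposite.op_surjective.exists]
    simp [← MulOpposite.unop_inj, inv_mul_cancel₀ hq, he00, he11]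

end
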